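/- arXiv:1807.00222 — 2 statements merged into one kernel-verified Lean document; each statement's English description precedes it below -/
import Mathlib

section
/- Let X be a regular curve, f : X → X a homeomorphism, and (M_n) a sequence of minimal sets of f converging in the Hausdorff metric to a nonempty closed set M. Then every point of M whose full orbit {f^n(x) : n ∈ ℤ} is infinite belongs to a minimal set of f contained in M. -/
open Set Filter Metric Topology

/-- The defining condition of a regular curve: every point has arbitrarily small
open neighborhoods with finite boundary. (Together with the instance assumptions
`Nonempty`, `CompactSpace`, `ConnectedSpace` on a metric space, this says `X` is a
regular curve.) -/
def regularCurveAx (X : Type*) [MetricSpace X] : Prop :=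
  ∀ (x : X) (V : Set X), IsOpen V → x ∈ V →
    ∃ U : Set X, IsOpen U ∧ x ∈ U ∧ U ⊆ V ∧ (frontier U).Finite

/-- The ω-limit set of `x` under `f`: all limits of `f^[n i] x` along a strictly
increasing sequence of integers `n`. -/
def omegaSet {X : Type*} [MetricSpace X] (f : X → X) (x : X) : Set X :=
  {y | ∃ n : ℕ → ℕ, StrictMono n ∧ Tendsto (fun i => f^[n i] x) atTop (𝓝 y)}

/-- `M` is a minimal set of `f`: nonempty, closed, strongly invariant, and without
any proper nonempty closed strongly invariant subset. -/
def IsMinimalSet {X : Type*} [MetricSpace X] (f : X → X) (M : Set X) : Prop :=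
  M.Nonempty ∧ IsClosed M ∧ f '' M = M ∧
    ∀ N : Set X, N ⊆ M → N.Nonempty → IsClosed N → f '' N = N → N = M

/-! ### Topology of regular curves -/

theorem IsPreconnected.inter_frontier_nonempty_of_mem {X : Type*} [TopologicalSpace X]
    {E U : Set X} (hE : IsPreconnected E) {a b : X} (ha : a ∈ E) (hb : b ∈ E)
    (haU : a ∈ closure U) (hbU : b ∉ U) : (E ∩ frontier U).Nonempty := by
  by_contra h
  rw [not_nonempty_iff_eq_empty] at h
  have hsub : E ⊆ interior U ∪ (closure U)ᶜ := by
    intro y hy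
    by_cases h1 : y ∈ interior U
    · exact Or.inl h1
    · refine Or.inr fun h2 => ?_
      have : y ∈ E ∩ frontier U := ⟨hy, h2, h1⟩
      simp [h] at this
  have ha' : a ∈ interior U := by
    rcases hsub ha with h1 | h1
    · exact h1
    · exact absurd haU h1
  have hb' : b ∈ (closure U)ᶜ := by
    rcases hsub hb with h1 | h1
    · exact absurd (interior_subset h1) hbU
    · exact h1
  obtain ⟨y, -, hy1, hy2⟩ := hE _ _ isOpen_interior isClosed_closure.isOpen_compl hsub
    ⟨a, ha, ha'⟩ ⟨b, hb, hb'⟩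
  exact hy2 (interior_subset_closure hy1)

section RegularCurve

variable {X : Type*} [MetricSpace X]

theorem regularCurveAx.exists_closure_subset (hreg : regularCurveAx X) {x : X} {V : Set X}
    (hV : V ∈ 𝓝 x) :
    ∃ U : Set X, IsOpen U ∧ x ∈ U ∧ closure U ⊆ V ∧ (frontier U).Finite := by
  obtain ⟨ε, hε, hball⟩ := Metric.mem_nhds_iff.1 hV
  obtain ⟨U, hUo, hxU, hUV, hfin⟩ := hreg x (ball x (ε / 2)) isOpen_ball
    (mem_ball_self (half_pos hε))
  refine ⟨U, hUo, hxU, ?_, hfin⟩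
  refine (closure_mono hUV).trans (closure_ball_subset_closedBall.trans ?_)
  exact (closedBall_subset_ball (half_lt_self hε)).trans hball

theorem regularCurveAx.exists_preconnected_nhd [ConnectedSpace X] (hreg : regularCurveAx X)
    {x : X} {V : Set X} (hV : V ∈ 𝓝 x) : ∃ E ⊆ V, IsPreconnected E ∧ E ∈ 𝓝 x := by
  classical
  obtain ⟨U, hUo, hxU, hUV, hfin⟩ := hreg.exists_closure_subset hV
  let P : ℕ → Prop := fun n => ∃ E ⊆ closure U, IsClosed E ∧ IsClosed (closure U \ E) ∧ x ∈ E ∧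
    (E ∩ frontier U).ncard = n
  have hP : ∃ n, P n := ⟨_, closure U, Subset.rfl, isClosed_closure, by simp,
    subset_closure hxU, rfl⟩
  obtain ⟨E, hEU, hEc, hEc', hxE, hn⟩ := Nat.find_spec hP
  refine ⟨E, hEU.trans hUV, ?_, ?_⟩
  · rw [isPreconnected_iff_subset_of_fully_disjoint_closed hEc]
    have key : ∀ u v : Set X, IsClosed u → IsClosed v → E ⊆ u ∪ v → Disjoint u v → x ∈ u →
        E ⊆ u := by
      intro u v hu hv huv hd hxu
      have hdiff : closure U \ (E ∩ u) = closure U \ E ∪ E ∩ v := by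
        ext y
        constructor
        · rintro ⟨h1, h2⟩
          by_cases hyE : y ∈ E
          · refine Or.inr ⟨hyE, (huv hyE).resolve_left fun h => h2 ⟨hyE, h⟩⟩
          · exact Or.inl ⟨h1, hyE⟩
        · rintro (⟨h1, h2⟩ | ⟨h1, h2⟩)
          · exact ⟨h1, fun h => h2 h.1⟩
          · exact ⟨hEU h1, fun h => Set.disjoint_left.1 hd h.2 h2⟩
      have hle : (E ∩ frontier U).ncard ≤ (E ∩ u ∩ frontier U).ncard := by
        rw [hn]
        refine Nat.find_min' hP ⟨E ∩ u, inter_subset_left.trans hEU, hEc.inter hu, ?_,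
          ⟨hxE, hxu⟩, rfl⟩
        rw [hdiff]
        exact hEc'.union (hEc.inter hv)
      have heq : E ∩ u ∩ frontier U = E ∩ frontier U :=
        Set.eq_of_subset_of_ncard_le (fun y hy => ⟨hy.1.1, hy.2⟩) hle
          (hfin.subset inter_subset_right)
      have hvU : E ∩ v ⊆ U := by
        intro y hy
        by_contra hyU
        have : y ∈ E ∩ frontier U := ⟨hy.1, by rw [hUo.frontier_eq]; exact ⟨hEU hy.1, hyU⟩⟩
        rw [← heq] at this
        exact Set.disjoint_left.1 hd this.1.2 hy.2
      have hopen : IsOpen (E ∩ v) := by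
        have : E ∩ v = U \ (closure U \ E ∪ E ∩ u) := by
          ext y
          constructor
          · intro hy
            refine ⟨hvU hy, ?_⟩
            rintro (h | h)
            · exact h.2 hy.1
            · exact Set.disjoint_left.1 hd h.2 hy.2
          · rintro ⟨h1, h2⟩
            have hyE : y ∈ E := by
              by_contra h
              exact h2 (Or.inl ⟨subset_closure h1, h⟩)
            exact ⟨hyE, (huv hyE).resolve_left fun h => h2 (Or.inr ⟨hyE, h⟩)⟩
        rw [this]
        exact hUo.sdiff (hEc'.union (hEc.inter hu))
      have hclopen : IsClopen (E ∩ v) := ⟨hEc.inter hv, hopen⟩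
      have hxv : x ∉ E ∩ v := fun h => Set.disjoint_left.1 hd hxu h.2
      rcases isClopen_iff.1 hclopen with h | h
      · intro y hy
        refine (huv hy).resolve_right fun hyv => ?_
        have : y ∈ E ∩ v := ⟨hy, hyv⟩
        simp [h] at this
      · exact absurd (h ▸ mem_univ x) hxv
    intro u v hu hv huv hd
    rcases huv hxE with h | h
    · exact Or.inl (key u v hu hv huv hd h)
    · exact Or.inr (key v u hv hu (by rwa [union_comm]) hd.symm h)
  · have : U \ (closure U \ E) ∈ 𝓝 x := (hUo.sdiff hEc').mem_nhds ⟨hxU, fun h => h.2 hxE⟩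
    refine mem_of_superset this ?_
    rintro y ⟨h1, h2⟩
    by_contra h
    exact h2 ⟨subset_closure h1, h⟩

/-- In a compact regular curve, a finite set meets all preconnected sets of large diameter. -/
theorem regularCurveAx.exists_finite_transversal [CompactSpace X] (hreg : regularCurveAx X)
    {ε : ℝ} (hε : 0 < ε) :
    ∃ F : Set X, F.Finite ∧ ∀ E : Set X, IsPreconnected E → ∀ a ∈ E, ∀ b ∈ E, ε ≤ dist a b →
      (E ∩ F).Nonempty := by
  choose U hUo hxU hUb hUf using fun x : X =>
    hreg x (ball x (ε / 2)) isOpen_ball (mem_ball_self (half_pos hε))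
  obtain ⟨t, ht⟩ := isCompact_univ.elim_finite_subcover U hUo
    (fun x _ => mem_iUnion.2 ⟨x, hxU x⟩)
  refine ⟨⋃ x ∈ t, frontier (U x), t.finite_toSet.biUnion fun x _ => hUf x, ?_⟩
  intro E hE a ha b hb hab
  obtain ⟨x, hxt, hax⟩ := mem_iUnion₂.1 (ht (mem_univ a))
  have hbx : b ∉ U x := by
    intro hbx
    have h1 := mem_ball.1 (hUb x hax)
    have h2 := mem_ball'.1 (hUb x hbx)
    have := dist_triangle a x b
    linarith
  obtain ⟨y, hy1, hy2⟩ := hE.inter_frontier_nonempty_of_mem ha hb (subset_closure hax) hbx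
  exact ⟨y, hy1, mem_iUnion₂.2 ⟨x, hxt, hy2⟩⟩

theorem regularCurveAx.exists_finite_frontier_nhd [CompactSpace X] (hreg : regularCurveAx X)
    {N : Set X} (hN : IsClosed N) {x : X} (hx : x ∉ N) :
    ∃ V : Set X, IsOpen V ∧ N ⊆ V ∧ (frontier V).Finite ∧ x ∉ closure V := by
  have hchoose : ∀ y : X, ∃ U : Set X, IsOpen U ∧ (frontier U).Finite ∧ x ∉ closure U ∧
      (y ∈ N → y ∈ U) := by
    intro y
    by_cases hy : y ∈ N
    · obtain ⟨U, h1, h2, h3, h4⟩ := hreg.exists_closure_subset (x := y) (V := {x}ᶜ)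
        (isOpen_compl_singleton.mem_nhds fun h => hx (by rw [← mem_singleton_iff.1 h]; exact hy))
      exact ⟨U, h1, h4, fun h => h3 h rfl, fun _ => h2⟩
    · exact ⟨∅, isOpen_empty, by simp, by simp, fun h => absurd h hy⟩
  choose U hUo hUf hUx hU using hchoose
  obtain ⟨t, ht⟩ := hN.isCompact.elim_finite_subcover U hUo
    (fun y hy => mem_iUnion.2 ⟨y, hU y hy⟩)
  have hcl : closure (⋃ y ∈ t, U y) = ⋃ y ∈ t, closure (U y) := by
    rw [Finset.closure_biUnion]
  refine ⟨⋃ y ∈ t, U y, isOpen_biUnion fun y _ => hUo y, ht, ?_, ?_⟩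
  · refine (t.finite_toSet.biUnion fun y _ => hUf y).subset ?_
    have hopen : IsOpen (⋃ y ∈ t, U y) := isOpen_biUnion fun y _ => hUo y
    rw [hopen.frontier_eq, hcl]
    rintro z ⟨h1, h2⟩
    obtain ⟨y, hy, hzy⟩ := mem_iUnion₂.1 h1
    refine mem_iUnion₂.2 ⟨y, hy, ?_⟩
    rw [(hUo y).frontier_eq]
    exact ⟨hzy, fun h => h2 (mem_iUnion₂.2 ⟨y, hy, h⟩)⟩
  · rw [hcl]
    intro h
    obtain ⟨y, hy, hzy⟩ := mem_iUnion₂.1 h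
    exact hUx y hzy

end RegularCurve

/-! ### Minimal sets of a homeomorphism -/

section MinimalSets

variable {X : Type*} [MetricSpace X]

theorem Homeomorph.iterate_eq_pow {X : Type*} [TopologicalSpace X] (f : X ≃ₜ X) (n : ℕ) (x : X) :
    (⇑f)^[n] x = (f ^ n) x := by
  induction n generalizing x with
  | zero => simp
  | succ n ih => rw [Function.iterate_succ_apply, ih, pow_succ, Homeomorph.mul_apply]

theorem Homeomorph.image_symm_eq {X : Type*} [TopologicalSpace X] {f : X ≃ₜ X} {S : Set X}
    (h : f '' S = S) : f.symm '' S = S := by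
  conv_lhs => rw [← h]
  rw [← image_comp]
  simp

theorem IsMinimalSet.symm {f : X ≃ₜ X} {M : Set X} (h : IsMinimalSet f M) :
    IsMinimalSet f.symm M := by
  obtain ⟨h1, h2, h3, h4⟩ := h
  refine ⟨h1, h2, Homeomorph.image_symm_eq h3, fun N hN hne hcl hinv => h4 N hN hne hcl ?_⟩
  simpa using Homeomorph.image_symm_eq hinv

theorem exists_isMinimalSet_subset [CompactSpace X] (f : X ≃ₜ X) {C : Set X} (hne : C.Nonempty)
    (hcl : IsClosed C) (hinv : f '' C ⊆ C) : ∃ N ⊆ C, IsMinimalSet f N := by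
  obtain ⟨N, hNC, hN⟩ := zorn_superset_nonempty
    {D : Set X | D.Nonempty ∧ IsClosed D ∧ f '' D ⊆ D} (by
      intro c hc hchain hcne
      refine ⟨⋂₀ c, ⟨?_, isClosed_sInter fun s hs => (hc hs).2.1, ?_⟩,
        fun s hs => sInter_subset_of_mem hs⟩
      · have := hcne.to_subtype
        refine IsCompact.nonempty_sInter_of_directed_nonempty_isCompact_isClosed
          ?_ (fun s hs => (hc hs).1)
          (fun s hs => (hc hs).2.1.isCompact) (fun s hs => (hc hs).2.1)
        intro a ha b hb
        rcases hchain.total ha hb with h | h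
        · exact ⟨a, ha, Subset.rfl, h⟩
        · exact ⟨b, hb, h, Subset.rfl⟩
      · rintro _ ⟨y, hy, rfl⟩ s hs
        exact (hc hs).2.2 ⟨y, hy s hs, rfl⟩) C ⟨hne, hcl, hinv⟩
  obtain ⟨⟨hN1, hN2, hN3⟩, hmin⟩ := hN
  refine ⟨N, hNC, hN1, hN2, ?_, ?_⟩
  · refine Subset.antisymm hN3 (hmin ⟨hN1.image _, f.isClosedMap _ hN2, image_mono hN3⟩ hN3)
  · intro D hD hDne hDcl hDinv
    exact Subset.antisymm hD (hmin ⟨hDne, hDcl, hDinv.subset⟩ hD)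

theorem IsMinimalSet.subset_of_image_subset [CompactSpace X] {f : X ≃ₜ X} {M S : Set X}
    (hM : IsMinimalSet f M) (hS : IsClosed S) (hinv : f '' S ⊆ S) (hne : (M ∩ S).Nonempty) :
    M ⊆ S := by
  obtain ⟨N, hN, hN1, hN2, hN3, -⟩ := exists_isMinimalSet_subset f hne (hM.2.1.inter hS)
    ((image_inter_subset _ _ _).trans (inter_subset_inter hM.2.2.1.subset hinv))
  rw [← hM.2.2.2 N (hN.trans inter_subset_left) hN1 hN2 hN3]
  exact hN.trans inter_subset_right

/-- A minimal set meeting a closed set `K` comparable with its image under the `r`-th iterate is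
covered by the first `r` images of `K`. -/
theorem IsMinimalSet.subset_iUnion_image_pow [CompactSpace X] {f : X ≃ₜ X} {M K : Set X}
    (hM : IsMinimalSet f M) (hK : IsClosed K) (hne : (M ∩ K).Nonempty) {r : ℕ} (hr : 0 < r)
    (h : (f ^ r) '' K ⊆ K ∨ K ⊆ (f ^ r) '' K) : M ⊆ ⋃ i ∈ Finset.range r, (f ^ i) '' K := by
  have hcl : IsClosed (⋃ i ∈ Finset.range r, (f ^ i) '' K) :=
    isClosed_biUnion_finset fun i _ => (f ^ i).isClosedMap _ hK
  have hne' : (M ∩ ⋃ i ∈ Finset.range r, (f ^ i) '' K).Nonempty := by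
    obtain ⟨y, hy1, hy2⟩ := hne
    exact ⟨y, hy1, mem_iUnion₂.2 ⟨0, Finset.mem_range.2 hr, y, hy2, by simp⟩⟩
  rcases h with h | h
  · refine hM.subset_of_image_subset hcl ?_ hne'
    rintro _ ⟨y, hy, rfl⟩
    obtain ⟨i, hi, z, hz, rfl⟩ := mem_iUnion₂.1 hy
    rw [← Homeomorph.mul_apply, ← pow_succ']
    rcases Nat.lt_or_ge (i + 1) r with h1 | h1
    · exact mem_iUnion₂.2 ⟨i + 1, Finset.mem_range.2 h1, z, hz, rfl⟩
    · have : i + 1 = r := by have := Finset.mem_range.1 hi; omega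
      rw [this]
      exact mem_iUnion₂.2 ⟨0, Finset.mem_range.2 hr, _, h ⟨z, hz, rfl⟩, by simp⟩
  · refine hM.symm.subset_of_image_subset hcl ?_ hne'
    rintro _ ⟨y, hy, rfl⟩
    obtain ⟨i, hi, z, hz, rfl⟩ := mem_iUnion₂.1 hy
    rcases i with _ | i
    · obtain ⟨u, hu, rfl⟩ := h hz
      refine mem_iUnion₂.2 ⟨r - 1, Finset.mem_range.2 (by omega), u, hu, ?_⟩
      obtain ⟨s, rfl⟩ : ∃ s, r = s + 1 := ⟨r - 1, by omega⟩
      simp [pow_succ' f s]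
    · have := Finset.mem_range.1 hi
      refine mem_iUnion₂.2 ⟨i, Finset.mem_range.2 (by omega), z, hz, ?_⟩
      simp [pow_succ']

end MinimalSets

/-! ### Frontiers of intersections and unions -/

theorem Set.ncard_add_ncard_le_of_union_subset_of_inter_subset {α : Type*} {A B C D : Set α}
    (hC : C.Finite) (hD : D.Finite) (h1 : A ∪ B ⊆ C ∪ D) (h2 : A ∩ B ⊆ C ∩ D) :
    A.ncard + B.ncard ≤ C.ncard + D.ncard ∧
      (C.ncard + D.ncard ≤ A.ncard + B.ncard → C ∩ D ⊆ A) := by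
  have hA : A.Finite := (hC.union hD).subset (subset_union_left.trans h1)
  have hB : B.Finite := (hC.union hD).subset (subset_union_right.trans h1)
  have e1 := ncard_union_add_ncard_inter A B hA hB
  have e2 := ncard_union_add_ncard_inter C D hC hD
  have l1 := ncard_le_ncard h1 (hC.union hD)
  have l2 := ncard_le_ncard h2 (hC.inter_of_left D)
  refine ⟨by omega, fun h => ?_⟩
  rw [← eq_of_subset_of_ncard_le h2 (by omega) (hC.inter_of_left D)]
  exact inter_subset_left

section Frontier

variable {X : Type*} [TopologicalSpace X] {U W : Set X}

theorem frontier_inter_subset_union (U W : Set X) :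
    frontier (U ∩ W) ⊆ frontier U ∪ frontier W :=
  (frontier_inter_subset U W).trans
    (union_subset_union inter_subset_left inter_subset_right)

theorem frontier_union_subset_union (U W : Set X) :
    frontier (U ∪ W) ⊆ frontier U ∪ frontier W :=
  (frontier_union_subset U W).trans
    (union_subset_union inter_subset_left inter_subset_right)

theorem frontier_submodular (hU : (frontier U).Finite) (hW : (frontier W).Finite) :
    (frontier (U ∩ W)).ncard + (frontier (U ∪ W)).ncard ≤
        (frontier U).ncard + (frontier W).ncard ∧
      ((frontier U).ncard + (frontier W).ncard ≤
        (frontier (U ∩ W)).ncard + (frontier (U ∪ W)).ncard →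
        frontier U ∩ frontier W ⊆ frontier (U ∩ W)) := by
  refine ncard_add_ncard_le_of_union_subset_of_inter_subset hU hW
    (union_subset (frontier_inter_subset_union U W) (frontier_union_subset_union U W)) ?_
  rintro y ⟨⟨h1, -⟩, -, h2⟩
  exact ⟨⟨closure_mono inter_subset_left h1, fun h => h2 (interior_mono subset_union_left h)⟩,
    closure_mono inter_subset_right h1, fun h => h2 (interior_mono subset_union_right h)⟩

theorem closure_inter_closure_subset_of_frontier (hU : IsOpen U) (hW : IsOpen W)
    (h : frontier U ∩ frontier W ⊆ frontier (U ∩ W)) :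
    closure U ∩ closure W ⊆ closure (U ∩ W) := by
  rintro y ⟨h1, h2⟩
  by_cases hyU : y ∈ U
  · exact hU.inter_closure ⟨hyU, h2⟩
  by_cases hyW : y ∈ W
  · exact hW.closure_inter ⟨h1, hyW⟩
  · refine frontier_subset_closure (h ⟨?_, ?_⟩)
    · rw [hU.frontier_eq]; exact ⟨h1, hyU⟩
    · rw [hW.frontier_eq]; exact ⟨h2, hyW⟩

end Frontier

/-! ### Cuts -/

theorem Nat.exists_eventually_const_of_concave {μ : ℕ → ℕ} (hmono : Monotone μ)
    (hconc : ∀ s, μ (s + 2) + μ s ≤ 2 * μ (s + 1)) (hlt : ∃ s, μ s < s) :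
    ∃ s₀, 0 < s₀ ∧ ∀ s, s₀ ≤ s → μ s = μ s₀ := by
  have h1 : ∃ s, μ (s + 1) = μ s := by
    by_contra! h
    obtain ⟨s, hs⟩ := hlt
    have : ∀ t, t ≤ μ t := by
      intro t
      induction t with
      | zero => simp
      | succ t ih =>
        have := hmono (Nat.le_succ t)
        have := h t
        simp only [Nat.succ_eq_add_one] at *
        omega
    exact absurd (this s) (by omega)
  obtain ⟨s₁, hs₁⟩ := h1
  have h2 : ∀ t, μ (s₁ + t + 1) = μ (s₁ + t) := by
    intro t
    induction t with
    | zero => simpa using hs₁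
    | succ t ih =>
      have a1 := hconc (s₁ + t)
      have a2 : μ (s₁ + t + 1) ≤ μ (s₁ + t + 2) := hmono (by omega)
      change μ (s₁ + t + 2) = μ (s₁ + t + 1)
      omega
  have h3 : ∀ t, μ (s₁ + t) = μ s₁ := by
    intro t
    induction t with
    | zero => simp
    | succ t ih => rw [← add_assoc, h2 t, ih]
  refine ⟨s₁ + 1, by omega, fun s hs => ?_⟩
  obtain ⟨t, rfl⟩ : ∃ t, s = s₁ + t := ⟨s - s₁, by omega⟩
  rw [h3, h3]

/-- `IsCut f v N w s U`: the set `U` is an open neighborhood of `N` with finite frontier which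
misses `f ^ k v` for all integers `k` in the window `[w, w + s)`. -/
structure IsCut {X : Type*} [TopologicalSpace X] (f : X ≃ₜ X) (v : X) (N : Set X) (w : ℤ) (s : ℕ)
    (U : Set X) : Prop where
  isOpen : IsOpen U
  subset : N ⊆ U
  finite : (frontier U).Finite
  notMem : ∀ k : ℤ, w ≤ k → k < w + s → (f ^ k) v ∉ U

/-- Cuts whose frontier has exactly `m` points. -/
structure IsTightCut {X : Type*} [TopologicalSpace X] (f : X ≃ₜ X) (v : X) (N : Set X) (s m : ℕ)
    (w : ℤ) (U : Set X) : Prop extends IsCut f v N w s U where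
  ncard_eq : (frontier U).ncard = m

/-- The intersection of the closures of all tight cuts whose closure contains `z`. -/
def cutHull {X : Type*} [TopologicalSpace X] (f : X ≃ₜ X) (v : X) (N : Set X) (s m : ℕ)
    (w : ℤ) (z : X) : Set X :=
  {y | ∀ U, IsTightCut f v N s m w U → z ∈ closure U → y ∈ closure U}

section Cuts

variable {X : Type*} [TopologicalSpace X] {f : X ≃ₜ X} {v : X} {N U W : Set X} {w w' : ℤ}
  {s s' m : ℕ}

theorem Homeomorph.image_zpow_eq (hN : f '' N = N) (n : ℤ) : (f ^ n) '' N = N := by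
  induction n with
  | zero => ext y; simp
  | succ n ih =>
    conv_rhs => rw [← ih, ← hN]
    rw [zpow_add_one, ← image_comp]
    rfl
  | pred n ih =>
    conv_rhs => rw [← ih, ← Homeomorph.image_symm_eq hN]
    rw [zpow_sub_one, ← image_comp]
    rfl

theorem Homeomorph.image_pow_eq (hN : f '' N = N) (n : ℕ) : (f ^ n) '' N = N := by
  simpa using Homeomorph.image_zpow_eq hN (n : ℤ)

theorem ncard_frontier_image (g : X ≃ₜ X) (U : Set X) :
    (frontier (g '' U)).ncard = (frontier U).ncard := by
  rw [← g.image_frontier, ncard_image_of_injective _ g.injective]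

theorem IsCut.of_window (h : IsCut f v N w s U) (h1 : w ≤ w') (h2 : w' + s' ≤ w + s) :
    IsCut f v N w' s' U :=
  ⟨h.isOpen, h.subset, h.finite, fun k hk1 hk2 => h.notMem k (by omega) (by omega)⟩

theorem IsCut.image (hN : f '' N = N) (h : IsCut f v N w s U) (n : ℤ) :
    IsCut f v N (n + w) s ((f ^ n) '' U) where
  isOpen := (f ^ n).isOpenMap _ h.isOpen
  subset := by
    conv_lhs => rw [← Homeomorph.image_zpow_eq hN n]
    exact image_mono h.subset
  finite := by
    rw [← Homeomorph.image_frontier]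
    exact h.finite.image _
  notMem := by
    rintro k hk1 hk2 ⟨u, hu, hk⟩
    refine h.notMem (k - n) (by omega) (by omega) ?_
    have : (f ^ (k - n)) v = u := by
      apply (f ^ n).injective
      rw [hk, ← Homeomorph.mul_apply, ← zpow_add]
      congr 2
      ring
    rwa [this]

theorem IsCut.inter (hU : IsCut f v N w s U) (hW : IsCut f v N w' s' W) :
    IsCut f v N w s (U ∩ W) :=
  ⟨hU.isOpen.inter hW.isOpen, subset_inter hU.subset hW.subset,
    (hU.finite.union hW.finite).subset (frontier_inter_subset_union U W),
    fun k h1 h2 h => hU.notMem k h1 h2 h.1⟩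

theorem IsCut.union (hU : IsCut f v N w s U) (hW : IsCut f v N w s W) :
    IsCut f v N w s (U ∪ W) :=
  ⟨hU.isOpen.union hW.isOpen, hU.subset.trans subset_union_left,
    (hU.finite.union hW.finite).subset (frontier_union_subset_union U W),
    fun k h1 h2 h => h.elim (hU.notMem k h1 h2) (hW.notMem k h1 h2)⟩

theorem IsCut.exists_of_concave (f : X ≃ₜ X) (v : X) (N : Set X) (hN : f '' N = N)
    (hex : ∀ s, ∃ U, IsCut f v N 0 s U) (hlt : ∃ s U, IsCut f v N 0 s U ∧ (frontier U).ncard < s) :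
    ∃ s₀ m, 0 < s₀ ∧ (∀ w U, IsCut f v N w s₀ U → m ≤ (frontier U).ncard) ∧
      ∀ w s, s₀ ≤ s → ∃ U, IsCut f v N w s U ∧ (frontier U).ncard = m := by
  classical
  have hP : ∀ s, ∃ n, ∃ U, IsCut f v N 0 s U ∧ (frontier U).ncard = n := fun s =>
    let ⟨U, hU⟩ := hex s
    ⟨_, U, hU, rfl⟩
  let μ : ℕ → ℕ := fun s => Nat.find (hP s)
  have hμ : ∀ s, ∃ U, IsCut f v N 0 s U ∧ (frontier U).ncard = μ s := fun s =>
    Nat.find_spec (hP s)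
  have hμle : ∀ s w U, IsCut f v N w s U → μ s ≤ (frontier U).ncard := by
    intro s w U hU
    refine Nat.find_min' (hP s) ⟨_, ?_, ncard_frontier_image (f ^ (-w)) U⟩
    simpa using hU.image hN (-w)
  obtain ⟨s₀, hs₀, hconst⟩ := Nat.exists_eventually_const_of_concave (μ := μ) (by
      intro s t hst
      obtain ⟨U, hU, hn⟩ := hμ t
      rw [← hn]
      exact hμle s 0 U (hU.of_window le_rfl (by omega))) (by
      intro s
      obtain ⟨U, hU, hn⟩ := hμ (s + 1)
      have hU' : IsCut f v N 1 (s + 1) (f '' U) := by simpa using hU.image hN 1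
      have hn' : (frontier (f '' U)).ncard = μ (s + 1) := by rw [ncard_frontier_image, hn]
      have h1 : IsCut f v N 0 (s + 2) (U ∩ f '' U) := by
        refine ⟨(hU.inter hU').isOpen, (hU.inter hU').subset, (hU.inter hU').finite, ?_⟩
        rintro k hk1 hk2 ⟨hk3, hk4⟩
        rcases eq_or_lt_of_le hk1 with h | h
        · exact hU.notMem k hk1 (by omega) hk3
        · exact hU'.notMem k (by omega) (by push_cast at *; omega) hk4
      have h2 : IsCut f v N 1 s (U ∪ f '' U) :=
        (hU.of_window (by omega) (by push_cast; omega)).union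
          (hU'.of_window (by omega) (by push_cast; omega))
      have a1 := hμle _ _ _ h1
      have a2 := hμle _ _ _ h2
      have a3 := (frontier_submodular hU.finite hU'.finite).1
      omega) (by
      obtain ⟨s, U, hU, h⟩ := hlt
      exact ⟨s, (hμle s 0 U hU).trans_lt h⟩)
  refine ⟨s₀, μ s₀, hs₀, hμle s₀, fun w s hs => ?_⟩
  obtain ⟨U, hU, hn⟩ := hμ s
  refine ⟨(f ^ w) '' U, by simpa using hU.image hN w, ?_⟩
  rw [ncard_frontier_image, hn, hconst s hs]

theorem IsTightCut.image (hN : f '' N = N) (h : IsTightCut f v N s m w U) (n : ℤ) :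
    IsTightCut f v N s m (n + w) ((f ^ n) '' U) :=
  ⟨h.toIsCut.image hN n, by rw [ncard_frontier_image, h.ncard_eq]⟩

theorem IsTightCut.inter_union
    (hmin : ∀ w U, IsCut f v N w s U → m ≤ (frontier U).ncard)
    (hU : IsTightCut f v N s m w U) (hW : IsTightCut f v N s m w W) :
    IsTightCut f v N s m w (U ∩ W) ∧ IsTightCut f v N s m w (U ∪ W) ∧
      closure U ∩ closure W ⊆ closure (U ∩ W) := by
  have h1 := hU.toIsCut.inter hW.toIsCut
  have h2 := hU.toIsCut.union hW.toIsCut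
  obtain ⟨h3, h4⟩ := frontier_submodular hU.finite hW.finite
  have h5 := hmin _ _ h1
  have h6 := hmin _ _ h2
  have e1 := hU.ncard_eq
  have e2 := hW.ncard_eq
  exact ⟨⟨h1, by omega⟩, ⟨h2, by omega⟩,
    closure_inter_closure_subset_of_frontier hU.isOpen hW.isOpen (h4 (by omega))⟩

theorem IsTightCut.biInter (hmin : ∀ w U, IsCut f v N w s U → m ≤ (frontier U).ncard)
    {ι : Type*} {t : Finset ι} (ht : t.Nonempty) {A : ι → Set X}
    (hA : ∀ i ∈ t, IsTightCut f v N s m w (A i)) {z : X} (hz : ∀ i ∈ t, z ∈ closure (A i)) :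
    IsTightCut f v N s m w (⋂ i ∈ t, A i) ∧ z ∈ closure (⋂ i ∈ t, A i) := by
  classical
  induction ht using Finset.Nonempty.cons_induction with
  | singleton a => simpa using ⟨hA a (by simp), hz a (by simp)⟩
  | cons a t ha ht ih =>
    obtain ⟨h1, h2⟩ := ih (fun i hi => hA i (by simp [hi])) (fun i hi => hz i (by simp [hi]))
    have := IsTightCut.inter_union hmin (hA a (by simp)) h1
    rw [Finset.cons_eq_insert, Finset.set_biInter_insert]
    exact ⟨this.1, this.2.2 ⟨hz a (by simp), h2⟩⟩

theorem IsTightCut.biUnion (hmin : ∀ w U, IsCut f v N w s U → m ≤ (frontier U).ncard)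
    {ι : Type*} {t : Finset ι} (ht : t.Nonempty) {A : ι → Set X}
    (hA : ∀ i ∈ t, IsTightCut f v N s m w (A i)) :
    IsTightCut f v N s m w (⋃ i ∈ t, A i) := by
  classical
  induction ht using Finset.Nonempty.cons_induction with
  | singleton a => simpa using hA a (by simp)
  | cons a t ha ht ih =>
    have h1 := ih (fun i hi => hA i (by simp [hi]))
    have := IsTightCut.inter_union hmin (hA a (by simp)) h1
    rw [Finset.cons_eq_insert, Finset.set_biUnion_insert]
    exact this.2.1

theorem isClosed_cutHull (z : X) : IsClosed (cutHull f v N s m w z) := by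
  have : cutHull f v N s m w z =
      ⋂ U, ⋂ (_ : IsTightCut f v N s m w U), ⋂ (_ : z ∈ closure U), closure U := by
    ext y
    simp [cutHull]
  rw [this]
  exact isClosed_iInter fun _ => isClosed_iInter fun _ => isClosed_iInter fun _ => isClosed_closure

theorem cutHull_subset_of_mem {z z' : X} (h : z ∈ cutHull f v N s m w z') :
    cutHull f v N s m w z ⊆ cutHull f v N s m w z' :=
  fun _ hy U hU hz => hy U hU (h U hU hz)

theorem image_cutHull_subset (hN : f '' N = N) (n : ℤ) (z : X) :
    (f ^ n) '' cutHull f v N s m w z ⊆ cutHull f v N s m (n + w) ((f ^ n) z) := by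
  rintro _ ⟨y, hy, rfl⟩ U hU hz
  have hU' := hU.image hN (-n)
  rw [neg_add_cancel_left] at hU'
  have key : ∀ u, u ∈ closure ((f ^ (-n)) '' U) ↔ (f ^ n) u ∈ closure U := by
    intro u
    rw [← Homeomorph.image_closure]
    constructor
    · rintro ⟨t, ht, rfl⟩
      rwa [← Homeomorph.mul_apply, ← zpow_add, add_neg_cancel, zpow_zero, Homeomorph.one_apply]
    · intro h
      refine ⟨_, h, ?_⟩
      rw [← Homeomorph.mul_apply, ← zpow_add, neg_add_cancel, zpow_zero, Homeomorph.one_apply]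
  exact (key y).1 (hy _ hU' ((key z).2 hz))

theorem image_cutHull (hN : f '' N = N) (n : ℤ) (z : X) :
    (f ^ n) '' cutHull f v N s m w z = cutHull f v N s m (n + w) ((f ^ n) z) := by
  refine Subset.antisymm (image_cutHull_subset hN n z) fun y hy => ?_
  have := image_cutHull_subset hN (-n) _ ⟨y, hy, rfl⟩
  rw [neg_add_cancel_left, ← Homeomorph.mul_apply, ← zpow_add, neg_add_cancel, zpow_zero,
    Homeomorph.one_apply] at this
  refine ⟨_, this, ?_⟩
  rw [← Homeomorph.mul_apply, ← zpow_add, add_neg_cancel, zpow_zero, Homeomorph.one_apply]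

theorem cutHull_subset_of_isTightCut
    (hmin : ∀ w U, IsCut f v N w s U → m ≤ (frontier U).ncard)
    (h : IsTightCut f v N s m w U) (h' : IsTightCut f v N s m w' U) {z : X}
    (hz : z ∈ closure U) : cutHull f v N s m w z ⊆ cutHull f v N s m w' z := by
  intro y hy W hW hzW
  obtain ⟨h1, -, h2⟩ := IsTightCut.inter_union hmin h' hW
  exact closure_mono inter_subset_right
    (hy (U ∩ W) ⟨h.toIsCut.inter hW.toIsCut, h1.ncard_eq⟩ (h2 ⟨hz, hzW⟩))

theorem exists_mem_cutHull_of_isTightCut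
    (hmin : ∀ w U, IsCut f v N w s U → m ≤ (frontier U).ncard)
    {z : ℕ → X} {B : ℕ → Set X} (hB : ∀ i ≤ m, IsTightCut f v N s m w (B i))
    (hz : ∀ i ≤ m, z i ∈ frontier (B i)) :
    ∃ i ≤ m, ∃ j ≤ m, i ≠ j ∧ z i ∈ cutHull f v N s m w (z j) := by
  classical
  by_contra! hcon
  have hex : ∀ i j, i ≤ m → j ≤ m → ∃ U, IsTightCut f v N s m w U ∧ z j ∈ closure U ∧
      (i ≠ j → z i ∉ closure U) ∧ (i = j → U = B j) := by
    intro i j hi hj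
    by_cases hij : i = j
    · exact ⟨B j, hB j hj, frontier_subset_closure (hz j hj), fun h => absurd hij h, fun _ => rfl⟩
    · have := hcon i hi j hj hij
      simp only [cutHull, mem_ofPred_eq, not_forall] at this
      obtain ⟨U, h1, h2, h3⟩ := this
      exact ⟨U, h1, h2, fun _ => h3, fun h => absurd h hij⟩
  choose! A hA hA1 hA2 hA3 using hex
  have hne : (Finset.range (m + 1)).Nonempty := ⟨0, by simp⟩
  have hle : ∀ i, i ∈ Finset.range (m + 1) ↔ i ≤ m := fun i => by
    rw [Finset.mem_range, Nat.lt_succ_iff]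
  have hC : ∀ j ≤ m, IsTightCut f v N s m w (⋂ i ∈ Finset.range (m + 1), A i j) ∧
      z j ∈ closure (⋂ i ∈ Finset.range (m + 1), A i j) := fun j hj =>
    IsTightCut.biInter hmin hne (fun i hi => hA i j ((hle i).1 hi) hj)
      (fun i hi => hA1 i j ((hle i).1 hi) hj)
  have hV := IsTightCut.biUnion hmin hne
    (A := fun j => ⋂ i ∈ Finset.range (m + 1), A i j) fun j hj => (hC j ((hle j).1 hj)).1
  have hzV : ∀ j ≤ m, z j ∈
      frontier (⋃ j ∈ Finset.range (m + 1), ⋂ i ∈ Finset.range (m + 1), A i j) := by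
    intro j hj
    rw [hV.isOpen.frontier_eq]
    refine ⟨closure_mono (subset_biUnion_of_mem (u := fun j => ⋂ i ∈ Finset.range (m + 1), A i j)
      (Finset.mem_coe.2 ((hle j).2 hj))) (hC j hj).2, fun h => ?_⟩
    obtain ⟨i, hi, hji⟩ := mem_iUnion₂.1 h
    have hji' := mem_iInter₂.1 hji j ((hle j).2 hj)
    by_cases hij : j = i
    · subst hij
      rw [hA3 j j hj hj rfl] at hji'
      have := hz j hj
      rw [(hB j hj).isOpen.frontier_eq] at this
      exact this.2 hji'
    · exact hA2 j i hj ((hle i).1 hi) hij (subset_closure hji')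
  have hinj : Set.InjOn z (Finset.range (m + 1)) := by
    intro i hi j hj hij
    by_contra hne
    refine hcon i ((hle i).1 hi) j ((hle j).1 hj) hne ?_
    rw [hij]
    exact fun _ _ h => h
  have hcard : (z '' (Finset.range (m + 1))).ncard = m + 1 := by
    rw [hinj.ncard_image, ncard_coe_finset, Finset.card_range]
  have hsub : z '' (Finset.range (m + 1)) ⊆
      frontier (⋃ j ∈ Finset.range (m + 1), ⋂ i ∈ Finset.range (m + 1), A i j) := by
    rintro _ ⟨j, hj, rfl⟩
    exact hzV j ((hle j).1 hj)
  have := ncard_le_ncard hsub hV.finite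
  rw [hV.ncard_eq, hcard] at this
  omega

theorem IsTightCut.exists_mem_cutHull [PreconnectedSpace X]
    (hmin : ∀ w U, IsCut f v N w s U → m ≤ (frontier U).ncard)
    (hs : 0 < s) (hU : IsTightCut f v N s m w U) {C : Set X} (hC : IsPreconnected C)
    (hCU : C ⊆ U) {n y : X} (hnN : n ∈ N) (hn : n ∈ C) (hy : y ∈ C) :
    ∃ z ∈ frontier U, y ∈ cutHull f v N s m w z := by
  classical
  by_contra! hcon
  have hex : ∀ z, z ∈ frontier U → ∃ W, IsTightCut f v N s m w W ∧ z ∈ closure W ∧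
      y ∉ closure W := by
    intro z hz
    have := hcon z hz
    simpa only [cutHull, mem_ofPred_eq, not_forall, exists_prop] using this
  choose! A hA hA1 hA2 using hex
  have hne : hU.finite.toFinset.Nonempty := by
    rw [Set.Finite.toFinset_nonempty, nonempty_frontier_iff]
    refine ⟨⟨n, hCU hn⟩, fun h => hU.notMem w le_rfl (by omega) (h ▸ mem_univ _)⟩
  have hmem : ∀ z, z ∈ hU.finite.toFinset ↔ z ∈ frontier U := fun z => by simp
  have hV := IsTightCut.biUnion hmin hne fun z hz => hA z ((hmem z).1 hz)
  obtain ⟨hW, -, hcl⟩ := IsTightCut.inter_union hmin hU hV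
  have hsub : frontier U ⊆ frontier (U ∩ ⋃ z ∈ hU.finite.toFinset, A z) := by
    intro z hz
    rw [hW.isOpen.frontier_eq]
    refine ⟨hcl ⟨frontier_subset_closure hz, ?_⟩, fun h => ?_⟩
    · exact closure_mono (subset_biUnion_of_mem (u := A) (Finset.mem_coe.2 ((hmem z).2 hz)))
        (hA1 z hz)
    · rw [hU.isOpen.frontier_eq] at hz
      exact hz.2 h.1
  have heq := eq_of_subset_of_ncard_le hsub (by rw [hW.ncard_eq, hU.ncard_eq]) hW.finite
  obtain ⟨p, hp1, hp2⟩ := hC.inter_frontier_nonempty_of_mem hn hy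
    (subset_closure (hW.subset hnN)) (fun h => by
      obtain ⟨z, hz, hyz⟩ := mem_iUnion₂.1 h.2
      exact hA2 z ((hmem z).1 hz) (subset_closure hyz))
  rw [← heq, hU.isOpen.frontier_eq] at hp2
  exact hp2.2 (hCU hp1)

end Cuts

section Trapping

variable {X : Type*} [MetricSpace X] {f : X ≃ₜ X} {v : X}
  {N U : Set X} {w : ℤ} {s m : ℕ}

theorem IsTightCut.minimalSet_subset [CompactSpace X] [ConnectedSpace X] (hN : f '' N = N)
    (hmin : ∀ w U, IsCut f v N w s U → m ≤ (frontier U).ncard) (hs : 0 < s)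
    (hU : ∀ k : ℤ, w - m ≤ k → k ≤ w → IsTightCut f v N s m k U) {C : Set X}
    (hC : IsPreconnected C) (hCU : C ⊆ U) {n y : X} (hnN : n ∈ N) (hn : n ∈ C) (hy : y ∈ C)
    {Q : Set X} (hQ : IsMinimalSet f Q) (hyQ : y ∈ Q) :
    Q ⊆ ⋃ i ∈ Finset.range m, (f ^ i) '' closure U := by
  have hUw := hU w (by omega) le_rfl
  obtain ⟨z, hz, hyz⟩ := hUw.exists_mem_cutHull hmin hs hC hCU hnN hn hy
  set K := cutHull f v N s m w z with hK
  have hKU : K ⊆ closure U := fun u hu => hu U hUw (frontier_subset_closure hz)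
  have hzf : ∀ i : ℕ, (f ^ i) z ∈ frontier ((f ^ i) '' U) := by
    intro i
    rw [← Homeomorph.image_frontier]
    exact ⟨z, hz, rfl⟩
  have hT : ∀ i : ℕ, i ≤ m → IsTightCut f v N s m w ((f ^ i) '' U) := by
    intro i hi
    have := (hU (w - i) (by omega) (by omega)).image hN i
    rwa [add_sub_cancel, zpow_natCast] at this
  have hT' : ∀ i : ℕ, IsTightCut f v N s m (i + w) ((f ^ i) '' U) := by
    intro i
    have := hUw.image hN i
    rwa [zpow_natCast] at this
  have hKi : ∀ i ≤ m, (f ^ i) '' K = cutHull f v N s m w ((f ^ i) z) := by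
    intro i hi
    have := image_cutHull (s := s) (m := m) (v := v) (w := w) hN (i : ℤ) z
    rw [zpow_natCast] at this
    rw [hK, this]
    exact Subset.antisymm
      (cutHull_subset_of_isTightCut hmin (hT' i) (hT i hi) (frontier_subset_closure (hzf i)))
      (cutHull_subset_of_isTightCut hmin (hT i hi) (hT' i) (frontier_subset_closure (hzf i)))
  obtain ⟨i, hi, j, hj, hij, hmem⟩ := exists_mem_cutHull_of_isTightCut hmin
    (z := fun i => (f ^ i) z) (B := fun i => (f ^ i) '' U) hT (fun i _ => hzf i)
  have hsub := cutHull_subset_of_mem hmem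
  beta_reduce at hsub
  rw [← hKi i hi, ← hKi j hj] at hsub
  have hshift : ∀ a b : ℕ, (f ^ (a + b)) '' K = (f ^ a) '' ((f ^ b) '' K) := by
    intro a b
    rw [pow_add, ← image_comp]
    rfl
  have hcancel : ∀ (a : ℕ) {S T : Set X}, (f ^ a) '' S ⊆ (f ^ a) '' T → S ⊆ T :=
    fun a S T => (image_subset_image_iff (f ^ a).injective).1
  obtain ⟨r, hr, hrm, hrK⟩ : ∃ r, 0 < r ∧ r ≤ m ∧ ((f ^ r) '' K ⊆ K ∨ K ⊆ (f ^ r) '' K) := by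
    rcases lt_or_gt_of_ne hij with h | h
    · refine ⟨j - i, by omega, by omega, Or.inr (hcancel i ?_)⟩
      rw [← hshift]
      rwa [show i + (j - i) = j by omega]
    · refine ⟨i - j, by omega, by omega, Or.inl (hcancel j ?_)⟩
      rw [← hshift]
      rwa [show j + (i - j) = i by omega]
  refine (hQ.subset_iUnion_image_pow (isClosed_cutHull z) ⟨y, hyQ, hyz⟩ hr hrK).trans ?_
  intro u hu
  obtain ⟨k, hk, hku⟩ := mem_iUnion₂.1 hu
  exact mem_iUnion₂.2 ⟨k, Finset.mem_range.2 ((Finset.mem_range.1 hk).trans_le hrm),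
    image_mono hKU hku⟩

/-- If the points `f ^ (k + i) v`, for `i < m * (m + 1)`, avoid `U` and follow the injective orbit
of `x` closely, then a frontier with `m` points is too small to keep that orbit in the union of
the first `m` images of `closure U`. -/
theorem not_forall_mem_iUnion_image_pow {x : X} (hfin : (frontier U).Finite)
    (hcard : (frontier U).ncard = m) {k : ℤ} {D : ℕ → Set X}
    (hD : ∀ i < m * (m + 1), IsPreconnected (D i)) (hxD : ∀ i < m * (m + 1), (f ^ i) x ∈ D i)
    (hdisj : ∀ i < m * (m + 1), ∀ j < m * (m + 1), i ≠ j → Disjoint (D i) (D j))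
    (hvD : ∀ i : ℕ, i < m * (m + 1) → (f ^ (k + i)) v ∈ D i)
    (hvU : ∀ i : ℕ, i < m * (m + 1) → (f ^ (k + i)) v ∉ U) :
    ¬ ∀ i : ℕ, (f ^ i) x ∈ ⋃ j ∈ Finset.range m, (f ^ j) '' closure U := by
  intro hcon
  have hex : ∀ j : ℕ, j ≤ m → ∃ b p, j * m ≤ b ∧ b < (j + 1) * m ∧ p ∈ frontier U ∧ p ∈ D b := by
    intro j hj
    obtain ⟨i, hi, u, hu, hux⟩ := mem_iUnion₂.1 (hcon (j * m + m - 1))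
    have hi := Finset.mem_range.1 hi
    have hb1 : j * m ≤ j * m + m - 1 - i := by omega
    have hb2 : j * m + m - 1 - i < (j + 1) * m := by rw [add_one_mul]; omega
    have hbT : j * m + m - 1 - i < m * (m + 1) := by
      refine hb2.trans_le ?_
      rw [mul_comm m]
      exact Nat.mul_le_mul_right _ (by omega)
    have hu' : (f ^ (j * m + m - 1 - i)) x = u := by
      apply (f ^ i).injective
      rw [hux, ← Homeomorph.mul_apply, ← pow_add]
      congr 2
      omega
    obtain ⟨p, hp1, hp2⟩ := (hD _ hbT).inter_frontier_nonempty_of_mem (hxD _ hbT) (hvD _ hbT)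
      (by rw [hu']; exact hu) (hvU _ hbT)
    exact ⟨_, p, hb1, hb2, hp2, hp1⟩
  have : Nonempty X := ⟨x⟩
  choose! b p hb1 hb2 hp hpD using hex
  have hbT : ∀ j ≤ m, b j < m * (m + 1) := fun j hj => by
    refine (hb2 j hj).trans_le ?_
    rw [mul_comm m]
    exact Nat.mul_le_mul_right _ (by omega)
  have hlt : ∀ i ≤ m, ∀ j ≤ m, i < j → b i ≠ b j := by
    intro i hi j hj hij h
    have h1 := hb2 i hi
    have h2 := hb1 j hj
    have h3 : (i + 1) * m ≤ j * m := Nat.mul_le_mul_right _ hij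
    omega
  have hinj : Set.InjOn p ((Finset.range (m + 1) : Finset ℕ) : Set ℕ) := by
    intro i hi j hj hij
    have hi : i ≤ m := by simpa [Nat.lt_succ_iff] using hi
    have hj : j ≤ m := by simpa [Nat.lt_succ_iff] using hj
    by_contra hne
    have hbne : b i ≠ b j := by
      rcases lt_or_gt_of_ne hne with h | h
      · exact hlt i hi j hj h
      · exact (hlt j hj i hi h).symm
    refine Set.disjoint_left.1 (hdisj _ (hbT i hi) _ (hbT j hj) hbne) (hpD i hi) ?_
    rw [hij]
    exact hpD j hj
  have hsub : p '' (Finset.range (m + 1)) ⊆ frontier U := by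
    rintro _ ⟨j, hj, rfl⟩
    exact hp j (by simpa [Nat.lt_succ_iff] using hj)
  have := ncard_le_ncard hsub hfin
  rw [hcard, hinj.ncard_image, ncard_coe_finset, Finset.card_range] at this
  omega

theorem exists_pairwise_disjoint_preconnected_nhd [ConnectedSpace X]
    (hreg : regularCurveAx X) {y : ℕ → X}
    (hy : Function.Injective y) (T : ℕ) :
    ∃ D : ℕ → Set X, (∀ i, IsPreconnected (D i)) ∧ (∀ i, D i ∈ 𝓝 (y i)) ∧
      ∀ i < T, ∀ j < T, i ≠ j → Disjoint (D i) (D j) := by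
  obtain ⟨V, hV, hdis⟩ := ((Finset.range T).finite_toSet.image y).t2_separation
  choose D hDV hD hDn using fun i =>
    hreg.exists_preconnected_nhd ((hV (y i)).2.mem_nhds (hV (y i)).1)
  refine ⟨D, hD, hDn, fun i hi j hj hij => ?_⟩
  exact (hdis ⟨i, by simpa using hi, rfl⟩ ⟨j, by simpa using hj, rfl⟩ (hy.ne hij)).mono
    (hDV i) (hDV j)

theorem exists_isCut [CompactSpace X] (hreg : regularCurveAx X) (hNcl : IsClosed N) {x : X}
    (hxN : x ∉ N) (hvN : ∀ k : ℤ, (f ^ k) v ∉ N)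
    (hrec : ∀ W ∈ 𝓝 x, {k : ℕ | (f ^ k) v ∈ W}.Infinite) :
    (∀ s, ∃ U, IsCut f v N 0 s U) ∧ ∃ s U, IsCut f v N 0 s U ∧ (frontier U).ncard < s := by
  classical
  obtain ⟨V, hVo, hNV, hVf, hxV⟩ := hreg.exists_finite_frontier_nhd hNcl hxN
  let P : ℕ → Set X := fun s =>
    (((Finset.range s).filter fun k => (f ^ k) v ∈ V).image fun k => (f ^ k) v : Finset X)
  have hPf : ∀ s, (P s).Finite := fun s => Finset.finite_toSet _
  have hmem : ∀ s y, y ∈ P s ↔ ∃ k, k < s ∧ (f ^ k) v ∈ V ∧ (f ^ k) v = y := by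
    intro s y
    simp [P, and_assoc]
  have hfr : ∀ s, frontier (V \ P s) ⊆ frontier V ∪ P s := by
    intro s
    have h1 : IsOpen (V \ P s) := hVo.sdiff (hPf s).isClosed
    rw [h1.frontier_eq, hVo.frontier_eq]
    rintro y ⟨h2, h3⟩
    by_cases hy : y ∈ P s
    · exact Or.inr hy
    · exact Or.inl ⟨closure_mono sdiff_subset h2, fun h => h3 ⟨h, hy⟩⟩
  have hcut : ∀ s, IsCut f v N 0 s (V \ P s) := by
    intro s
    refine ⟨hVo.sdiff (hPf s).isClosed, fun y hy => ⟨hNV hy, fun h => ?_⟩,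
      (hVf.union (hPf s)).subset (hfr s), ?_⟩
    · obtain ⟨k, -, -, rfl⟩ := (hmem s y).1 h
      refine hvN k ?_
      rwa [zpow_natCast]
    · rintro k hk1 hk2 ⟨h1, h2⟩
      lift k to ℕ using hk1
      rw [zpow_natCast] at h1 h2
      exact h2 ((hmem _ _).2 ⟨k, by omega, h1, rfl⟩)
  refine ⟨fun s => ⟨_, hcut s⟩, ?_⟩
  have hinf := hrec (closure V)ᶜ (isClosed_closure.isOpen_compl.mem_nhds hxV)
  obtain ⟨t, htsub, htcard⟩ := hinf.exists_subset_card_eq ((frontier V).ncard + 1)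
  obtain ⟨s, hs⟩ := t.exists_nat_subset_range
  refine ⟨s, _, hcut s, ?_⟩
  have h1 : (frontier (V \ P s)).ncard ≤ (frontier V).ncard + (P s).ncard :=
    (ncard_le_ncard (hfr s) (hVf.union (hPf s))).trans (ncard_union_le _ _)
  have h2 : (P s).ncard ≤ ((Finset.range s).filter fun k => (f ^ k) v ∈ V).card := by
    simp only [P]
    rw [ncard_coe_finset]
    exact Finset.card_image_le
  have h3 : t ⊆ (Finset.range s).filter fun k => ¬ (f ^ k) v ∈ V := by
    intro k hk
    refine Finset.mem_filter.2 ⟨hs hk, fun h => ?_⟩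
    exact htsub hk (subset_closure h)
  have h4 := Finset.card_le_card h3
  have h5 := Finset.card_filter_add_card_filter_not (s := Finset.range s)
    (fun k => (f ^ k) v ∈ V)
  rw [Finset.card_range] at h5
  omega

/-- In a regular curve, an injective forward orbit in the limit `M` of minimal sets cannot start at
a point `x` which some orbit approaches infinitely often, unless `x` lies in every nonempty closed
invariant subset of `M`. -/
theorem mem_of_forall_nhds_infinite [CompactSpace X] [ConnectedSpace X]
    (hreg : regularCurveAx X) {Q : ℕ → Set X}
    (hQ : ∀ l, IsMinimalSet f (Q l)) {M : Set X}
    (hlim : ∀ y ∈ M, ∀ W ∈ 𝓝 y, ∀ᶠ l in atTop, (Q l ∩ W).Nonempty)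
    (hNM : N ⊆ M) (hNne : N.Nonempty) (hNcl : IsClosed N) (hN : f '' N = N) {x : X}
    (hxM : ∀ k : ℕ, (f ^ k) x ∈ M) (hinj : Function.Injective fun k : ℕ => (f ^ k) x)
    (hrec : ∀ W ∈ 𝓝 x, {k : ℕ | (f ^ k) v ∈ W}.Infinite) : x ∈ N := by
  classical
  by_contra hxN
  have hvN : ∀ k : ℤ, (f ^ k) v ∉ N := by
    intro k hk
    obtain ⟨n, hn⟩ := (hrec Nᶜ (hNcl.isOpen_compl.mem_nhds hxN)).nonempty
    refine hn ?_
    rw [← Homeomorph.image_zpow_eq hN (n - k)]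
    refine ⟨_, hk, ?_⟩
    rw [← Homeomorph.mul_apply, ← zpow_add, sub_add_cancel, zpow_natCast]
  obtain ⟨hex, hlt⟩ := exists_isCut hreg hNcl hxN hvN hrec
  obtain ⟨s, m, hs, hmin, hU⟩ := IsCut.exists_of_concave f v N hN hex hlt
  obtain ⟨D, hD, hDn, hdisj⟩ := exists_pairwise_disjoint_preconnected_nhd hreg hinj (m * (m + 1))
  have hnhd : (⋂ i ∈ Finset.range (m * (m + 1)), (f ^ i) ⁻¹' D i) ∈ 𝓝 x := by
    rw [Filter.biInter_finset_mem]
    intro i _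
    exact (f ^ i).continuous.continuousAt.preimage_mem_nhds (hDn i)
  obtain ⟨k, hk⟩ := (hrec _ hnhd).nonempty
  obtain ⟨U, hUcut, hUcard⟩ := hU (k - m) (m + m * (m + 1) + s) (by omega)
  have htight : ∀ j : ℤ, (k : ℤ) - m ≤ j → j ≤ k → IsTightCut f v N s m j U :=
    fun j h1 h2 => ⟨hUcut.of_window h1 (by push_cast; nlinarith), hUcard⟩
  obtain ⟨n, hn⟩ := hNne
  obtain ⟨C, hCU, hC, hCn⟩ :=
    hreg.exists_preconnected_nhd (hUcut.isOpen.mem_nhds (hUcut.subset hn))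
  have hev : ∀ᶠ l in atTop, Q l ⊆ ⋃ i ∈ Finset.range m, (f ^ i) '' closure U := by
    filter_upwards [hlim n (hNM hn) C hCn] with l hl
    obtain ⟨y, hyQ, hyC⟩ := hl
    exact IsTightCut.minimalSet_subset hN hmin hs htight hC hCU hn (mem_of_mem_nhds hCn) hyC
      (hQ l) hyQ
  have hGcl : IsClosed (⋃ i ∈ Finset.range m, (f ^ i) '' closure U) :=
    isClosed_biUnion_finset fun i _ => (f ^ i).isClosedMap _ isClosed_closure
  refine not_forall_mem_iUnion_image_pow (v := v) (k := k) (D := D) (x := x) hUcut.finite hUcard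
    (fun i _ => hD i) (fun i _ => mem_of_mem_nhds (hDn i)) hdisj ?_ ?_ ?_
  · intro i hi
    have := mem_iInter₂.1 hk i (Finset.mem_range.2 hi)
    rw [mem_preimage, ← Homeomorph.mul_apply, ← pow_add, add_comm] at this
    exact_mod_cast this
  · intro i hi
    exact hUcut.notMem _ (by omega) (by push_cast; zify at hi; omega)
  · intro i
    by_contra h
    obtain ⟨l, hl1, hl2⟩ :=
      (hev.and (hlim _ (hxM i) _ (hGcl.isOpen_compl.mem_nhds h))).exists
    obtain ⟨y, hy1, hy2⟩ := hl2
    exact hy2 (hl1 hy1)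

end Trapping

/-! ### Orbits in limits of minimal sets -/

section Orbits

variable {X : Type*} [MetricSpace X] {f : X ≃ₜ X} {x : X}

theorem image_closure_range_pow_subset (f : X ≃ₜ X) (x : X) :
    f '' closure (range fun k : ℕ => (f ^ k) x) ⊆ closure (range fun k : ℕ => (f ^ k) x) := by
  rw [f.image_closure]
  refine closure_mono ?_
  rintro _ ⟨_, ⟨k, rfl⟩, rfl⟩
  exact ⟨k + 1, by simp [pow_succ']⟩

theorem finite_range_pow_of_pow_apply_eq {p : ℕ} (hp : 0 < p) (h : (f ^ p) x = x) :
    (range fun k : ℕ => (f ^ k) x).Finite := by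
  refine ((finite_Iio p).image fun k => (f ^ k) x).subset ?_
  rintro _ ⟨k, rfl⟩
  refine ⟨k % p, Nat.mod_lt _ hp, ?_⟩
  have hper : Function.IsPeriodicPt f p x := by
    rw [Function.IsPeriodicPt, Function.IsFixedPt, Homeomorph.iterate_eq_pow, h]
  have := hper.iterate_mod_apply k
  rwa [Homeomorph.iterate_eq_pow, Homeomorph.iterate_eq_pow] at this

theorem exists_pow_apply_eq_of_not_injective
    (h : ¬ Function.Injective fun k : ℕ => (f ^ k) x) : ∃ p, 0 < p ∧ (f ^ p) x = x := by
  have key : ∀ a b : ℕ, a < b → (f ^ a) x = (f ^ b) x → ∃ p, 0 < p ∧ (f ^ p) x = x := by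
    intro a b hab heq
    refine ⟨b - a, by omega, (f ^ a).injective ?_⟩
    rw [← Homeomorph.mul_apply, ← pow_add, heq]
    congr 2
    omega
  simp only [Function.Injective, not_forall] at h
  obtain ⟨a, b, heq, hne⟩ := h
  rcases lt_or_gt_of_ne hne with hab | hab
  · exact key a b hab heq
  · exact key b a hab heq.symm

theorem injective_inv_pow_of_infinite
    (h : ((range fun k : ℕ => (f ^ k) x) ∪ range fun k : ℕ => (f⁻¹ ^ k) x).Infinite) :
    Function.Injective fun k : ℕ => (f⁻¹ ^ k) x := by
  by_contra hcon
  obtain ⟨p, hp, hpx⟩ := exists_pow_apply_eq_of_not_injective hcon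
  have hpx' : (f ^ p) x = x := by
    conv_lhs => rw [← hpx]
    rw [← Homeomorph.mul_apply, inv_pow, mul_inv_cancel, Homeomorph.one_apply]
  exact h ((finite_range_pow_of_pow_apply_eq hp hpx').union
    (finite_range_pow_of_pow_apply_eq hp hpx))

/-- A point whose forward orbit is stable and which is a limit of points of minimal sets lies in
every minimal set contained in its forward orbit closure. -/
theorem mem_of_forall_dist_lt [CompactSpace X] {Q : ℕ → Set X}
    (hQ : ∀ l, IsMinimalSet f (Q l)) (hlim : ∀ W ∈ 𝓝 x, ∀ᶠ l in atTop, (Q l ∩ W).Nonempty)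
    (hstab : ∀ ε > 0, ∃ W ∈ 𝓝 x, ∀ y ∈ W, ∀ n : ℕ, dist ((f ^ n) y) ((f ^ n) x) < ε)
    {N : Set X} (hNne : N.Nonempty) (hNcl : IsClosed N) (hN : f '' N = N)
    (hNx : N ⊆ closure (range fun k : ℕ => (f ^ k) x)) : x ∈ N := by
  rw [← hNcl.closure_eq, Metric.mem_closure_iff]
  intro δ hδ
  obtain ⟨W, hW, hWd⟩ := hstab (δ / 3) (by positivity)
  obtain ⟨l, y, hyQ, hyW⟩ := (hlim W hW).exists
  obtain ⟨n, hn⟩ := hNne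
  let o : ℕ → X × X := fun k => ((f ^ k) x, (f ^ k) y)
  have hfst : Prod.fst '' closure (range o) = closure (range fun k : ℕ => (f ^ k) x) := by
    rw [← continuous_fst.isClosedMap.closure_image_eq_of_continuous continuous_fst, ← range_comp]
    rfl
  have hmem := hNx hn
  rw [← hfst] at hmem
  obtain ⟨⟨n', y'⟩, hny, rfl⟩ := hmem
  have hy'Q : y' ∈ Q l := by
    have hcl : IsClosed {q : X × X | q.2 ∈ Q l} := (hQ l).2.1.preimage continuous_snd
    refine closure_minimal ?_ hcl hny
    rintro _ ⟨k, rfl⟩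
    change (f ^ k) y ∈ Q l
    rw [← Homeomorph.image_pow_eq (hQ l).2.2.1 k]
    exact ⟨y, hyQ, rfl⟩
  have hclose : ∀ j : ℕ, dist ((f ^ j) y') ((f ^ j) n') ≤ δ / 3 := by
    intro j
    have hcl : IsClosed {q : X × X | dist ((f ^ j) q.2) ((f ^ j) q.1) ≤ δ / 3} :=
      isClosed_le (((f ^ j).continuous.comp continuous_snd).dist
        ((f ^ j).continuous.comp continuous_fst)) continuous_const
    refine closure_minimal ?_ hcl hny
    rintro _ ⟨k, rfl⟩
    change dist ((f ^ j) ((f ^ k) y)) ((f ^ j) ((f ^ k) x)) ≤ δ / 3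
    rw [← Homeomorph.mul_apply, ← Homeomorph.mul_apply, ← pow_add]
    exact (hWd y hyW _).le
  have hy : y ∈ closure (range fun k : ℕ => (f ^ k) y') :=
    (hQ l).subset_of_image_subset isClosed_closure (image_closure_range_pow_subset f y')
      ⟨y', hy'Q, subset_closure ⟨0, by simp⟩⟩ hyQ
  obtain ⟨_, ⟨j, rfl⟩, hj⟩ := Metric.mem_closure_iff.1 hy (δ / 3) (by positivity)
  refine ⟨(f ^ j) n', ?_, ?_⟩
  · rw [← Homeomorph.image_pow_eq hN j]
    exact ⟨n', hn, rfl⟩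
  · have h0 := hWd y hyW 0
    simp only [pow_zero, Homeomorph.one_apply] at h0
    rw [dist_comm] at h0
    have h1 := dist_triangle4 x y ((f ^ j) y') ((f ^ j) n')
    have h2 := hclose j
    beta_reduce at hj
    linarith

/-- At a point with unstable forward orbit, some backward orbit accumulates. -/
theorem exists_forall_nhds_infinite [CompactSpace X] [ConnectedSpace X]
    (hreg : regularCurveAx X)
    (hstab : ¬ ∀ ε > 0, ∃ W ∈ 𝓝 x, ∀ y ∈ W, ∀ n : ℕ, dist ((f ^ n) y) ((f ^ n) x) < ε) :
    ∃ v, ∀ W ∈ 𝓝 x, {k : ℕ | (f⁻¹ ^ k) v ∈ W}.Infinite := by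
  push Not at hstab
  obtain ⟨ε, hε, hunst⟩ := hstab
  obtain ⟨F, hF, hFE⟩ := hreg.exists_finite_transversal hε
  by_contra! hcon
  choose W hW hWfin using hcon
  have hA : (⋂ v ∈ F, W v) ∈ 𝓝 x := (Filter.biInter_mem hF).2 fun v _ => hW v
  obtain ⟨n₀, hn₀⟩ := (hF.biUnion fun v _ => hWfin v).bddAbove
  have hB : (⋂ k ∈ Finset.range (n₀ + 1), {y | dist ((f ^ k) y) ((f ^ k) x) < ε}) ∈ 𝓝 x := by
    rw [Filter.biInter_finset_mem]
    intro k _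
    exact (f ^ k).continuous.continuousAt (ball_mem_nhds _ hε)
  obtain ⟨E, hEV, hE, hEn⟩ := hreg.exists_preconnected_nhd (inter_mem hA hB)
  obtain ⟨y, hy, n, hn⟩ := hunst E hEn
  have hnn : n₀ < n := by
    by_contra h
    have := mem_iInter₂.1 (hEV hy).2 n (Finset.mem_range.2 (by omega))
    exact absurd hn (not_le.2 this)
  obtain ⟨_, ⟨u, hu, rfl⟩, hvF⟩ := hFE ((f ^ n) '' E) (hE.image _ (f ^ n).continuous.continuousOn)
    _ ⟨y, hy, rfl⟩ _ ⟨x, mem_of_mem_nhds hEn, rfl⟩ hn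
  have huW := mem_iInter₂.1 (hEV hu).1 _ hvF
  have hun : (f⁻¹ ^ n) ((f ^ n) u) = u := by
    rw [← Homeomorph.mul_apply, inv_pow, inv_mul_cancel, Homeomorph.one_apply]
  have : n ≤ n₀ := hn₀ (mem_iUnion₂.2 ⟨_, hvF, by
    change (f⁻¹ ^ n) ((f ^ n) u) ∈ W _
    rwa [hun]⟩)
  omega

theorem hausdorffEDist_ne_top_of_compactSpace [CompactSpace X] {A B : Set X} (hA : A.Nonempty)
    (hB : B.Nonempty) : hausdorffEDist A B ≠ ⊤ :=
  hausdorffEDist_ne_top_of_nonempty_of_bounded hA hB isBounded_of_compactSpace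
    isBounded_of_compactSpace

theorem eventually_inter_nonempty_of_tendsto_hausdorffDist [CompactSpace X] {Q : ℕ → Set X}
    {M : Set X} (hQ : ∀ l, (Q l).Nonempty)
    (hconv : Tendsto (fun l => hausdorffDist (Q l) M) atTop (𝓝 0)) :
    ∀ y ∈ M, ∀ W ∈ 𝓝 y, ∀ᶠ l in atTop, (Q l ∩ W).Nonempty := by
  intro y hy W hW
  obtain ⟨ε, hε, hball⟩ := Metric.mem_nhds_iff.1 hW
  filter_upwards [hconv.eventually (gt_mem_nhds hε)] with l hl
  obtain ⟨u, hu, hd⟩ := exists_dist_lt_of_hausdorffDist_lt' hy hl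
    (hausdorffEDist_ne_top_of_compactSpace (hQ l) ⟨y, hy⟩)
  exact ⟨u, hu, hball (mem_ball.2 hd)⟩

theorem mem_of_tendsto_hausdorffDist [CompactSpace X] {Q : ℕ → Set X} {M : Set X}
    (hQ : ∀ l, (Q l).Nonempty) (hM : M.Nonempty) (hMcl : IsClosed M)
    (hconv : Tendsto (fun l => hausdorffDist (Q l) M) atTop (𝓝 0)) {y : X}
    (hy : ∀ W ∈ 𝓝 y, ∀ᶠ l in atTop, (Q l ∩ W).Nonempty) : y ∈ M := by
  rw [← hMcl.closure_eq, Metric.mem_closure_iff]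
  intro ε hε
  obtain ⟨l, hl, u, hu, hud⟩ := ((hconv.eventually (gt_mem_nhds (half_pos hε))).and
    (hy _ (ball_mem_nhds y (half_pos hε)))).exists
  obtain ⟨t, ht, hd⟩ := exists_dist_lt_of_hausdorffDist_lt hu hl
    (hausdorffEDist_ne_top_of_compactSpace (hQ l) hM)
  refine ⟨t, ht, ?_⟩
  have := dist_triangle y u t
  have := mem_ball'.1 hud
  linarith

theorem mapsTo_of_tendsto_hausdorffDist [CompactSpace X] {Q : ℕ → Set X} {M : Set X}
    (hQ : ∀ l, IsMinimalSet f (Q l)) (hMcl : IsClosed M)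
    (hconv : Tendsto (fun l => hausdorffDist (Q l) M) atTop (𝓝 0)) : MapsTo f M M := by
  intro y hy
  refine mem_of_tendsto_hausdorffDist (fun l => (hQ l).1) ⟨y, hy⟩ hMcl hconv fun W hW => ?_
  filter_upwards [eventually_inter_nonempty_of_tendsto_hausdorffDist (fun l => (hQ l).1) hconv
    y hy _ (f.continuous.continuousAt.preimage_mem_nhds hW)] with l hl
  obtain ⟨u, hu1, hu2⟩ := hl
  exact ⟨f u, (hQ l).2.2.1 ▸ mem_image_of_mem f hu1, hu2⟩

theorem pow_mem_of_mapsTo {M : Set X} (h : MapsTo f M M) (hx : x ∈ M) (k : ℕ) :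
    (f ^ k) x ∈ M := by
  rw [← Homeomorph.iterate_eq_pow]
  exact h.iterate k hx

end Orbits

/-- Every point of a Hausdorff limit of minimal sets whose full orbit is infinite
belongs to a minimal set contained in the limit. -/
theorem mem_minimal_of_infinite_orbit {X : Type*} [MetricSpace X] [Nonempty X]
    [CompactSpace X] [ConnectedSpace X] (hreg : regularCurveAx X) (f : X ≃ₜ X)
    (Mseq : ℕ → Set X) (hMn : ∀ n, IsMinimalSet (⇑f) (Mseq n))
    (M : Set X) (hMne : M.Nonempty) (hMcl : IsClosed M)
    (hconv : Tendsto (fun n => hausdorffDist (Mseq n) M) atTop (𝓝 0)) :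
    ∀ x ∈ M,
      (Set.range (fun n : ℕ => (⇑f)^[n] x) ∪ Set.range (fun n : ℕ => (⇑f.symm)^[n] x)).Infinite →
      ∃ N : Set X, N ⊆ M ∧ x ∈ N ∧ IsMinimalSet (⇑f) N := by
  intro x hx hinf
  have hinf' : ((range fun k : ℕ => (f ^ k) x) ∪ range fun k : ℕ => (f⁻¹ ^ k) x).Infinite := by
    simp only [Homeomorph.iterate_eq_pow] at hinf
    exact hinf
  have hMf : MapsTo f M M := mapsTo_of_tendsto_hausdorffDist hMn hMcl hconv
  have hMs : MapsTo (f⁻¹ : X ≃ₜ X) M M :=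
    mapsTo_of_tendsto_hausdorffDist (f := f⁻¹) (fun l => (hMn l).symm) hMcl hconv
  have hlim := eventually_inter_nonempty_of_tendsto_hausdorffDist (fun l => (hMn l).1) hconv
  obtain ⟨N, hNx, hN⟩ := exists_isMinimalSet_subset f
    (C := closure (range fun k : ℕ => (f ^ k) x)) ⟨x, subset_closure ⟨0, by simp⟩⟩
    isClosed_closure (image_closure_range_pow_subset f x)
  have hNM : N ⊆ M := hNx.trans <| closure_minimal
    (by rintro _ ⟨k, rfl⟩; exact pow_mem_of_mapsTo hMf hx k) hMcl
  refine ⟨N, hNM, ?_, hN⟩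
  by_cases hstab : ∀ ε > 0, ∃ W ∈ 𝓝 x, ∀ y ∈ W, ∀ n : ℕ, dist ((f ^ n) y) ((f ^ n) x) < ε
  · exact mem_of_forall_dist_lt hMn (hlim x hx) hstab hN.1 hN.2.1 hN.2.2.1 hNx
  · obtain ⟨v, hv⟩ := exists_forall_nhds_infinite hreg hstab
    exact mem_of_forall_nhds_infinite (f := f⁻¹) hreg (fun l => (hMn l).symm) hlim hNM hN.1
      hN.2.1 (Homeomorph.image_symm_eq hN.2.2.1) (pow_mem_of_mapsTo hMs hx)
      (injective_inv_pow_of_infinite hinf') hv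
end

section
/- Let X be a regular curve and f : X → X a homeomorphism. Then the map ω_f : X → 2^X, x ↦ ω_f(x), into the hyperspace of nonempty closed subsets of X with the Hausdorff metric, is continuous at every point x whose ω-limit set ω_f(x) is infinite. -/
open Set Filter Metric Topology

theorem IsPreconnected.subset_of_disjoint_frontier {X : Type*} [TopologicalSpace X] {C U : Set X}
    (hC : IsPreconnected C) (hU : IsOpen U) (hd : Disjoint C (frontier U))
    (hne : (C ∩ U).Nonempty) : C ⊆ U := by
  refine hC.subset_left_of_subset_union hU (isClosed_closure (s := U)).isOpen_compl
    (disjoint_compl_right.mono_left subset_closure) (fun c hc => ?_) hne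
  by_cases h : c ∈ closure U
  · left
    by_contra hcU
    exact disjoint_left.1 hd hc ⟨h, by rwa [hU.interior_eq]⟩
  · exact Or.inr h

section RegularCurve

variable {X : Type*} [MetricSpace X]

/-- Every point has a preconnected neighborhood inside the closure of a given proper open
neighborhood with finite boundary. -/
theorem exists_isPreconnected_nhds_subset_closure [CompactSpace X] [ConnectedSpace X] {x : X}
    {U : Set X} (hU : IsOpen U) (hx : x ∈ U) (hfin : (frontier U).Finite) :
    ∃ C ∈ 𝓝 x, IsPreconnected C ∧ C ⊆ closure U := by
  let x' : closure U := ⟨x, subset_closure hx⟩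
  have : CompactSpace (closure U) := isCompact_iff_compactSpace.1 isClosed_closure.isCompact
  have hinter := connectedComponent_eq_iInter_isClopen x'
  have hsep : ∀ g : closure U, g ∉ connectedComponent x' →
      ∃ s : Set (closure U), IsClopen s ∧ x' ∈ s ∧ g ∉ s := by
    intro g hg
    rw [hinter] at hg
    simpa [and_assoc] using hg
  have hfin' : {g : closure U | (g : X) ∈ frontier U ∧ g ∉ connectedComponent x'}.Finite :=
    (hfin.preimage Subtype.val_injective.injOn).subset fun g hg => hg.1
  choose! s hs using hsep
  let H : Set (closure U) :=
    ⋂ g ∈ {g : closure U | (g : X) ∈ frontier U ∧ g ∉ connectedComponent x'}, s g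
  have hH : IsClopen H := hfin'.isClopen_biInter fun g hg => (hs g hg.2).1
  have hxH : x' ∈ H := mem_iInter₂.2 fun g hg => (hs g hg.2).2.1
  have hHsub : H ⊆ connectedComponent x' := by
    intro y hy
    by_contra hyC
    obtain ⟨h1, h2, h3⟩ := hs y hyC
    have hD : IsClopen (H \ s y) := hH.diff h1
    have hDU : ∀ g ∈ H \ s y, (g : X) ∈ U := by
      intro g hg
      by_contra hgU
      have hgf : (g : X) ∈ frontier U := ⟨g.2, by rwa [hU.interior_eq]⟩
      by_cases hgC : g ∈ connectedComponent x'
      · exact hg.2 (h1.connectedComponent_subset h2 hgC)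
      · exact (hs g hgC).2.2 (mem_iInter₂.1 hg.1 g ⟨hgf, hgC⟩)
    have hclosed : IsClosed (Subtype.val '' (H \ s y)) :=
      isClosed_closure.isClosedMap_subtype_val _ hD.1
    have hopen : IsOpen (Subtype.val '' (H \ s y)) := by
      obtain ⟨O, hO, hOeq⟩ := isOpen_induced_iff.1 hD.2
      have : Subtype.val '' (H \ s y) = O ∩ U := by
        rw [← hOeq]
        ext z
        constructor
        · rintro ⟨w, hw, rfl⟩
          exact ⟨hw, hDU w (hOeq ▸ hw)⟩
        · rintro ⟨hz, hzU⟩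
          exact ⟨⟨z, subset_closure hzU⟩, hz, rfl⟩
      rw [this]
      exact hO.inter hU
    rcases isClopen_iff.1 (⟨hclosed, hopen⟩ : IsClopen (Subtype.val '' (H \ s y))) with h | h
    · exact (h ▸ mem_image_of_mem _ ⟨hy, h3⟩ : (y : X) ∈ (∅ : Set X))
    · obtain ⟨w, hw, hwx⟩ := (h ▸ mem_univ x : x ∈ Subtype.val '' (H \ s y))
      have : w = x' := Subtype.ext hwx
      exact hw.2 (this ▸ h2)
  refine ⟨Subtype.val '' connectedComponent x', ?_,
    isPreconnected_connectedComponent.image _ continuous_subtype_val.continuousOn,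
    by rintro _ ⟨w, -, rfl⟩; exact w.2⟩
  obtain ⟨O, hO, hOeq⟩ := isOpen_induced_iff.1 hH.2
  filter_upwards [hU.mem_nhds hx, hO.mem_nhds (by rw [← hOeq] at hxH; exact hxH)] with z hzU hzO
  refine ⟨⟨z, subset_closure hzU⟩, hHsub ?_, rfl⟩
  rw [← hOeq]
  exact hzO

theorem regularCurveAx.locallyConnectedSpace [CompactSpace X] [ConnectedSpace X]
    (hreg : regularCurveAx X) : LocallyConnectedSpace X := by
  refine locallyConnectedSpace_of_connected_bases (fun _ s => s)
    (fun x s => s ∈ 𝓝 x ∧ IsPreconnected s) (fun x => hasBasis_self.2 fun V hV => ?_)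
    fun x s hs => hs.2
  obtain ⟨W, hW, hWc, hWV⟩ := exists_mem_nhds_isClosed_subset hV
  obtain ⟨U, hU, hxU, hUW, hfin⟩ := hreg x _ isOpen_interior (mem_interior_iff_mem_nhds.2 hW)
  obtain ⟨C, hC, hCp, hCU⟩ := exists_isPreconnected_nhds_subset_closure hU hxU hfin
  exact ⟨C, hC, hCp, hCU.trans
    ((closure_minimal (hUW.trans interior_subset) hWc).trans hWV)⟩

theorem frontier_biUnion_subset {ι : Type*} (t : Finset ι) (U : ι → Set X) :
    frontier (⋃ i ∈ t, U i) ⊆ ⋃ i ∈ t, frontier (U i) := by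
  classical
  induction t using Finset.induction_on with
  | empty => simp
  | insert a t _ ih =>
    rw [Finset.set_biUnion_insert, Finset.set_biUnion_insert]
    exact (frontier_union_subset _ _).trans
      (union_subset_union inter_subset_left (inter_subset_right.trans ih))

/-- In a regular curve, compact sets have arbitrarily small open neighborhoods with finite
boundary. -/
theorem regularCurveAx.exists_isOpen_finite_frontier (hreg : regularCurveAx X) {K V : Set X}
    (hK : IsCompact K) (hV : IsOpen V) (hKV : K ⊆ V) :
    ∃ U, IsOpen U ∧ K ⊆ U ∧ U ⊆ V ∧ (frontier U).Finite := by
  choose! U hU hxU hUV hfin using fun x (hx : x ∈ V) => hreg x V hV hx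
  obtain ⟨t, htK, ht⟩ := hK.elim_nhds_subcover U fun x hx =>
    (hU x (hKV hx)).mem_nhds (hxU x (hKV hx))
  refine ⟨⋃ i ∈ t, U i, isOpen_biUnion fun i hi => hU i (hKV (htK i hi)), ht,
    iUnion₂_subset fun i hi => hUV i (hKV (htK i hi)), ?_⟩
  exact (t.finite_toSet.biUnion fun i hi => hfin i (hKV (htK i hi))).subset
    (frontier_biUnion_subset t U)

theorem regularCurveAx.exists_isOpen_closure_subset_finite_frontier [CompactSpace X]
    (hreg : regularCurveAx X) {K V : Set X} (hK : IsClosed K) (hV : IsOpen V) (hKV : K ⊆ V) :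
    ∃ U, IsOpen U ∧ K ⊆ U ∧ closure U ⊆ V ∧ (frontier U).Finite := by
  obtain ⟨W, hW, hKW, hWV⟩ := normal_exists_closure_subset hK hV hKV
  obtain ⟨U, hU, hKU, hUW, hfin⟩ := hreg.exists_isOpen_finite_frontier hK.isCompact hW hKW
  exact ⟨U, hU, hKU, (closure_mono hUW).trans hWV, hfin⟩

/-- In a regular curve, for each `ε > 0` there is a finite set such that all preconnected sets
avoiding it have diameter less than `ε`. -/
theorem regularCurveAx.exists_finite_dist_lt [CompactSpace X] (hreg : regularCurveAx X) {ε : ℝ}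
    (hε : 0 < ε) :
    ∃ F : Set X, F.Finite ∧ ∀ C, IsPreconnected C → Disjoint C F →
      ∀ u ∈ C, ∀ v ∈ C, dist u v < ε := by
  choose U hU hxU hUV hfin using fun x => hreg x (ball x (ε / 2)) isOpen_ball
    (mem_ball_self (half_pos hε))
  obtain ⟨t, -, ht⟩ := isCompact_univ.elim_nhds_subcover U fun x _ => (hU x).mem_nhds (hxU x)
  refine ⟨⋃ i ∈ t, frontier (U i), t.finite_toSet.biUnion fun i _ => hfin i, ?_⟩
  intro C hC hd u hu v hv
  obtain ⟨i, hi, hui⟩ := mem_iUnion₂.1 (ht (mem_univ u))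
  have hCU := hC.subset_of_disjoint_frontier (hU i)
    (hd.mono_right (subset_biUnion_of_mem (u := fun i => frontier (U i)) hi)) ⟨u, hu, hui⟩
  have h1 := mem_ball.1 (hUV i (hCU hu))
  have h2 := mem_ball.1 (hUV i (hCU hv))
  linarith [dist_triangle_right u v i]

end RegularCurve


section OmegaLimit

variable {X : Type*} [MetricSpace X] (f : X ≃ₜ X)

theorem Homeomorph.iterate_eq_pow_apply (n : ℕ) (x : X) : f^[n] x = (f ^ n) x := by
  induction n with
  | zero => rfl
  | succ n ih => rw [Function.iterate_succ_apply', ih, pow_succ', Homeomorph.mul_apply]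

theorem Homeomorph.pow_add_apply (m n : ℕ) (x : X) : (f ^ (m + n)) x = (f ^ m) ((f ^ n) x) := by
  rw [pow_add, Homeomorph.mul_apply]

theorem Homeomorph.pow_succ_apply (n : ℕ) (x : X) : (f ^ (n + 1)) x = f ((f ^ n) x) := by
  rw [pow_succ', Homeomorph.mul_apply]

theorem Homeomorph.pow_apply_inv_pow_apply (n : ℕ) (x : X) : (f ^ n) ((f⁻¹ ^ n) x) = x := by
  rw [← Homeomorph.mul_apply, inv_pow, mul_inv_cancel, Homeomorph.one_apply]

theorem Homeomorph.inv_pow_apply_pow_apply (n : ℕ) (x : X) : (f⁻¹ ^ n) ((f ^ n) x) = x := by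
  rw [← Homeomorph.mul_apply, inv_pow, inv_mul_cancel, Homeomorph.one_apply]

theorem Homeomorph.mem_pow_image_iff {n : ℕ} {s : Set X} {x : X} :
    x ∈ (f ^ n) '' s ↔ (f⁻¹ ^ n) x ∈ s := by
  constructor
  · rintro ⟨u, hu, rfl⟩
    rwa [f.inv_pow_apply_pow_apply]
  · intro h
    exact ⟨_, h, f.pow_apply_inv_pow_apply n x⟩

theorem mem_omegaSet_iff {x y : X} :
    y ∈ omegaSet f x ↔ ∀ V ∈ 𝓝 y, ∃ᶠ n : ℕ in atTop, (f ^ n) x ∈ V := by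
  rw [← mapClusterPt_iff_frequently]
  simp only [omegaSet, f.iterate_eq_pow_apply]
  constructor
  · rintro ⟨n, hn, hy⟩
    exact hy.mapClusterPt.of_comp hn.tendsto_atTop
  · exact fun h => h.tendsto_subseq

theorem notMem_omegaSet_iff {x y : X} :
    y ∉ omegaSet f x ↔ ∃ V ∈ 𝓝 y, ∀ᶠ n : ℕ in atTop, (f ^ n) x ∉ V := by
  simp [mem_omegaSet_iff, Filter.not_frequently]

theorem isClosed_omegaSet (x : X) : IsClosed (omegaSet f x) := by
  rw [← isOpen_compl_iff, isOpen_iff_mem_nhds]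
  intro y hy
  obtain ⟨V, hV, h⟩ := (notMem_omegaSet_iff f).1 hy
  filter_upwards [eventually_mem_nhds_iff.2 hV] with z hz
  exact (notMem_omegaSet_iff f).2 ⟨V, hz, h⟩

theorem apply_mem_omegaSet {x y : X} (hy : y ∈ omegaSet f x) : f y ∈ omegaSet f x := by
  rw [mem_omegaSet_iff] at hy ⊢
  intro V hV
  have h := hy _ (f.continuous.continuousAt hV)
  refine (tendsto_add_atTop_nat 1).frequently (h.mono fun n hn => ?_)
  rw [f.pow_succ_apply]
  exact hn

theorem inv_apply_mem_omegaSet {x y : X} (hy : y ∈ omegaSet f x) : f⁻¹ y ∈ omegaSet f x := by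
  rw [mem_omegaSet_iff] at hy ⊢
  intro V hV
  have hV' : f '' V ∈ 𝓝 y := by
    have := f.isOpenMap.image_mem_nhds hV
    rwa [Homeomorph.inv_apply, f.apply_symm_apply] at this
  have h := ((hy _ hV').and_eventually (eventually_ge_atTop 1))
  refine (tendsto_sub_atTop_nat 1).frequently (h.mono fun n hn => ?_)
  obtain ⟨⟨v, hv, hvn⟩, h1⟩ := hn
  have : (f ^ n) x = f ((f ^ (n - 1)) x) := by
    rw [← f.pow_succ_apply, Nat.sub_add_cancel h1]
  rw [this] at hvn
  rwa [← f.injective hvn]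

theorem pow_apply_mem_omegaSet {x y : X} (hy : y ∈ omegaSet f x) (n : ℕ) :
    (f ^ n) y ∈ omegaSet f x := by
  induction n with
  | zero => simpa using hy
  | succ n ih => rw [f.pow_succ_apply]; exact apply_mem_omegaSet f ih

theorem inv_pow_apply_mem_omegaSet {x y : X} (hy : y ∈ omegaSet f x) (n : ℕ) :
    (f⁻¹ ^ n) y ∈ omegaSet f x := by
  induction n with
  | zero => simpa using hy
  | succ n ih => rw [f⁻¹.pow_succ_apply]; exact inv_apply_mem_omegaSet f ih

theorem omegaSet_subset_of_eventually {K : Set X} (hK : IsClosed K) {x : X}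
    (h : ∀ᶠ n : ℕ in atTop, (f ^ n) x ∈ K) : omegaSet f x ⊆ K := by
  intro y hy
  by_contra hyK
  exact (mem_omegaSet_iff f).1 hy _ (hK.isOpen_compl.mem_nhds hyK)
    (h.mono fun n hn => not_not.2 hn)

theorem omegaSet_inter_nonempty_of_frequently [CompactSpace X] {K : Set X} (hK : IsClosed K)
    {x : X} (h : ∃ᶠ n : ℕ in atTop, (f ^ n) x ∈ K) : (omegaSet f x ∩ K).Nonempty := by
  obtain ⟨y, hyK, φ, hφ, hy⟩ := hK.isCompact.tendsto_subseq' h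
  refine ⟨y, ⟨φ, hφ, ?_⟩, hyK⟩
  simp only [f.iterate_eq_pow_apply]
  exact hy

theorem eventually_mem_of_omegaSet_subset [CompactSpace X] {x : X} {V : Set X} (hV : IsOpen V)
    (h : omegaSet f x ⊆ V) : ∀ᶠ n : ℕ in atTop, (f ^ n) x ∈ V := by
  by_contra hcon
  obtain ⟨y, hy, hyV⟩ := omegaSet_inter_nonempty_of_frequently f hV.isClosed_compl
    (not_eventually.1 hcon)
  exact hyV (h hy)

theorem omegaSet_subset_of_tendsto_dist {u v : X}
    (h : Tendsto (fun n : ℕ => dist ((f ^ n) u) ((f ^ n) v)) atTop (𝓝 0)) :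
    omegaSet f u ⊆ omegaSet f v := by
  rintro y ⟨φ, hφ, hy⟩
  refine ⟨φ, hφ, ?_⟩
  simp only [f.iterate_eq_pow_apply] at hy ⊢
  exact (tendsto_iff_of_dist (h.comp hφ.tendsto_atTop)).1 hy

theorem omegaSet_subset_biUnion_pow {k : ℕ} (hk : 0 < k) (x : X) :
    omegaSet f x ⊆ ⋃ r ∈ Finset.range k, (f ^ r) '' omegaSet (f ^ k : X ≃ₜ X) x := by
  intro y hy
  by_contra hcon
  simp only [mem_iUnion, not_exists, f.mem_pow_image_iff, notMem_omegaSet_iff] at hcon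
  choose! V hV hVx using hcon
  have hW : ⋂ r ∈ Finset.range k, (f⁻¹ ^ r : X ≃ₜ X) ⁻¹' V r ∈ 𝓝 y :=
    (biInter_finset_mem _).2 fun r hr =>
      (f⁻¹ ^ r : X ≃ₜ X).continuous.continuousAt (hV r hr)
  refine (mem_omegaSet_iff f).1 hy _ hW ?_
  have hall := (eventually_all_finset (Finset.range k)).2 hVx
  filter_upwards [(Nat.tendsto_div_const_atTop hk.ne').eventually hall] with n hn hmem
  have hr := Finset.mem_range.2 (Nat.mod_lt n hk)
  refine hn _ hr ?_
  have := mem_iInter₂.1 hmem _ hr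
  rwa [mem_preimage, ← Nat.mod_add_div n k, f.pow_add_apply, Nat.mod_add_div,
    f.inv_pow_apply_pow_apply, pow_mul] at this

theorem omegaSet_subsingleton_of_apply_eq {x : X} (h : f x = x) : (omegaSet f x) ⊆ {x} := by
  refine omegaSet_subset_of_eventually f isClosed_singleton (Eventually.of_forall fun n => ?_)
  induction n with
  | zero => rfl
  | succ n ih => rw [f.pow_succ_apply, mem_singleton_iff.1 ih, h]; rfl

theorem pow_apply_ne_of_infinite_omegaSet {x : X} (hinf : (omegaSet f x).Infinite) {k : ℕ}
    (hk : 0 < k) : (f ^ k) x ≠ x := by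
  intro h
  refine hinf (Set.Finite.subset ?_ (omegaSet_subset_biUnion_pow f hk x))
  exact (Finset.finite_toSet _).biUnion fun r _ =>
    ((finite_singleton x).subset (omegaSet_subsingleton_of_apply_eq _ h)).image _

end OmegaLimit

section Dynamics

variable {X : Type*} [MetricSpace X] (f : X ≃ₜ X)

theorem exists_mem_disjoint_pow_image {C : Set X} {L t : ℕ}
    (hC : ∀ i, 0 < i → i ≤ L → Disjoint ((f ^ i) '' C) C) {J : Finset ℕ}
    (hJ : ∀ n ∈ J, t ≤ n ∧ n ≤ t + L) {F : Finset X} (hcard : F.card < J.card) :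
    ∃ n ∈ J, Disjoint ((f ^ n) '' C) (F : Set X) := by
  by_contra! hcon
  have hg : ∀ n ∈ J, ∃ g ∈ F, (f⁻¹ ^ n) g ∈ C := fun n hn => by
    obtain ⟨g, hgC, hgF⟩ := not_disjoint_iff.1 (hcon n hn)
    exact ⟨g, hgF, f.mem_pow_image_iff.1 hgC⟩
  obtain ⟨n₀, hn₀⟩ := Finset.card_pos.1 (F.card.zero_le.trans_lt hcard)
  have : Nonempty X := ⟨(hg n₀ hn₀).choose⟩
  choose! g hgF hgC using hg
  have key : ∀ n ∈ J, ∀ m ∈ J, n < m → g n ≠ g m := by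
    intro n hn m hm hnm heq
    have h1 := hgC n hn
    have h2 := hgC m hm
    refine disjoint_left.1 (hC (m - n) (by omega) (by have := hJ n hn; have := hJ m hm; omega))
      (f.mem_pow_image_iff.2 (?_ : (f⁻¹ ^ (m - n)) ((f⁻¹ ^ n) (g n)) ∈ C)) h1
    rwa [← f⁻¹.pow_add_apply, Nat.sub_add_cancel hnm.le, heq]
  obtain ⟨n, hn, m, hm, hne, heq⟩ := Finset.exists_ne_map_eq_of_card_lt_of_maps_to hcard hgF
  rcases lt_or_gt_of_ne hne with h | h
  · exact key n hn m hm h heq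
  · exact key m hm n hn h heq.symm

theorem exists_isPreconnected_nhds_disjoint_pow [LocallyConnectedSpace X] {x : X}
    (hx : ∀ k, 0 < k → (f ^ k) x ≠ x) (L : ℕ) {O : Set X} (hO : O ∈ 𝓝 x) :
    ∃ C ∈ 𝓝 x, C ⊆ O ∧ IsPreconnected C ∧
      ∀ i, 0 < i → i ≤ L → Disjoint ((f ^ i) '' C) C := by
  have h1 : ∀ i ∈ Set.Ioc 0 L, ∃ V ∈ 𝓝 x, Disjoint ((f ^ i) '' V) V := by
    intro i hi
    obtain ⟨A, hA, B, hB, hAB⟩ := Filter.disjoint_iff.1 (disjoint_nhds_nhds.2 (hx i hi.1))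
    refine ⟨B ∩ (f ^ i : X ≃ₜ X) ⁻¹' A,
      inter_mem hB ((f ^ i : X ≃ₜ X).continuous.continuousAt hA), ?_⟩
    refine hAB.mono ?_ inter_subset_left
    rintro _ ⟨u, hu, rfl⟩
    exact hu.2
  choose! V hV hVd using h1
  have hmem : O ∩ ⋂ i ∈ Set.Ioc 0 L, V i ∈ 𝓝 x :=
    inter_mem hO ((biInter_mem (Set.finite_Ioc 0 L)).2 hV)
  obtain ⟨C, hCsub, hCo, hxC, hCc⟩ :=
    locallyConnectedSpace_iff_subsets_isOpen_isConnected.1 inferInstance x _ hmem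
  refine ⟨C, hCo.mem_nhds hxC, hCsub.trans inter_subset_left, hCc.isPreconnected,
    fun i hi hiL => ?_⟩
  have hCV : C ⊆ V i := (hCsub.trans inter_subset_right).trans (biInter_subset_of_mem ⟨hi, hiL⟩)
  exact (hVd i ⟨hi, hiL⟩).mono (image_mono hCV) hCV

theorem exists_isPreconnected_nhds_eventually_disjoint [LocallyConnectedSpace X] {x : X}
    {F : Set X} (hF : F.Finite) (hx : ∀ g ∈ F, x ∉ omegaSet (f⁻¹ : X ≃ₜ X) g) {O : Set X}
    (hO : O ∈ 𝓝 x) :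
    ∃ C ∈ 𝓝 x, C ⊆ O ∧ IsPreconnected C ∧ ∀ᶠ n : ℕ in atTop, Disjoint ((f ^ n) '' C) F := by
  simp only [notMem_omegaSet_iff] at hx
  choose! V hV hVd using hx
  obtain ⟨C, hCsub, hCo, hxC, hCc⟩ :=
    locallyConnectedSpace_iff_subsets_isOpen_isConnected.1 inferInstance x _
      (inter_mem hO ((biInter_mem hF).2 hV))
  refine ⟨C, hCo.mem_nhds hxC, hCsub.trans inter_subset_left, hCc.isPreconnected, ?_⟩
  filter_upwards [(eventually_all_finite hF).2 hVd] with n hn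
  refine disjoint_right.2 fun g hg hgC => hn g hg ?_
  exact mem_iInter₂.1 (hCsub (f.mem_pow_image_iff.1 hgC)).2 g hg

variable [CompactSpace X] [ConnectedSpace X]

/-- If a non-periodic point `x` belongs to the α-limit set of `p`, then this α-limit set is the
ω-limit set of `x`. -/
theorem omegaSet_inv_eq_of_mem (hreg : regularCurveAx X) {x p : X}
    (hx : ∀ k, 0 < k → (f ^ k) x ≠ x) (hxp : x ∈ omegaSet (f⁻¹ : X ≃ₜ X) p) :
    omegaSet (f⁻¹ : X ≃ₜ X) p = omegaSet f x := by
  have := hreg.locallyConnectedSpace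
  apply Subset.antisymm
  · intro y hy
    by_contra hyM
    obtain ⟨U, hU, hMU, hUy, hfin⟩ := hreg.exists_isOpen_closure_subset_finite_frontier
      (isClosed_omegaSet f x) isOpen_compl_singleton (subset_compl_singleton_iff.2 hyM)
    have hyU : y ∉ closure U := fun h => hUy h rfl
    have hfreq := (mem_omegaSet_iff _).1 hy _ (isClosed_closure.isOpen_compl.mem_nhds hyU)
    obtain ⟨J, hJ, hJcard⟩ := (Nat.frequently_atTop_iff_infinite.1 hfreq).exists_subset_card_eq
      (hfin.toFinset.card + 1)
    obtain ⟨L, hL⟩ : ∃ L, ∀ j ∈ J, j ≤ L := ⟨J.sup id, fun j hj => Finset.le_sup (f := id) hj⟩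
    obtain ⟨C, hCx, -, hCp, hCd⟩ := exists_isPreconnected_nhds_disjoint_pow f hx L univ_mem
    obtain ⟨N, hN⟩ := eventually_atTop.1 (eventually_mem_of_omegaSet_subset f hU hMU)
    obtain ⟨m, hm, hmC⟩ := frequently_atTop.1 ((mem_omegaSet_iff _).1 hxp C hCx) (N + L)
    have hinj : Set.InjOn (fun j => m - j) (J : Set ℕ) := fun a ha b hb hab => by
      have := hL a ha
      have := hL b hb
      simp only at hab
      omega
    obtain ⟨n, hn, hnd⟩ := exists_mem_disjoint_pow_image f hCd (t := m - L)
      (J := J.image fun j => m - j) (F := hfin.toFinset)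
      (by
        intro n hn
        obtain ⟨j, hj, rfl⟩ := Finset.mem_image.1 hn
        have := hL j hj
        omega)
      (by rw [Finset.card_image_of_injOn hinj, hJcard]; exact Nat.lt_succ_self _)
    obtain ⟨j, hj, rfl⟩ := Finset.mem_image.1 hn
    have hjL := hL j hj
    rw [hfin.coe_toFinset] at hnd
    have hsub := (hCp.image _
      (f ^ (m - j) : X ≃ₜ X).continuous.continuousOn).subset_of_disjoint_frontier hU hnd
      ⟨_, mem_image_of_mem _ (mem_of_mem_nhds hCx), hN _ (by omega)⟩
    refine hJ hj (subset_closure (hsub ⟨_, hmC, ?_⟩))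
    conv_lhs => rw [← Nat.sub_add_cancel (show j ≤ m by omega), f⁻¹.pow_add_apply]
    rw [Nat.add_sub_cancel, f.pow_apply_inv_pow_apply]
  · refine omegaSet_subset_of_eventually f (isClosed_omegaSet _ p)
      (Eventually.of_forall fun n => ?_)
    simpa using inv_pow_apply_mem_omegaSet f⁻¹ hxp n

end Dynamics

section Lower

variable {X : Type*} [MetricSpace X] [CompactSpace X] [ConnectedSpace X] (f : X ≃ₜ X)

theorem Homeomorph.inv_pow_apply_ne {Y : Type*} [TopologicalSpace Y] (f : Y ≃ₜ Y) {x : Y}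
    (hx : ∀ k, 0 < k → (f ^ k) x ≠ x) (k : ℕ) (hk : 0 < k) : (f⁻¹ ^ k) x ≠ x := by
  intro h
  refine hx k hk ?_
  conv_lhs => rw [← h]
  rw [← Homeomorph.mul_apply, inv_pow, mul_inv_cancel, Homeomorph.one_apply]

/-- If a non-periodic point `p` belongs to the ω-limit set of `g`, then this ω-limit set is the
α-limit set of `p`. -/
theorem omegaSet_eq_inv_of_mem (hreg : regularCurveAx X) {p g : X}
    (hp : ∀ k, 0 < k → (f ^ k) p ≠ p) (hpg : p ∈ omegaSet f g) :
    omegaSet f g = omegaSet (f⁻¹ : X ≃ₜ X) p := by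
  have := omegaSet_inv_eq_of_mem f⁻¹ hreg (f.inv_pow_apply_ne hp) (p := g)
  rw [inv_inv] at this
  exact this hpg

theorem eventually_omegaSet_inter_closedBall_nonempty (hreg : regularCurveAx X) {x : X}
    (hx : ∀ k, 0 < k → (f ^ k) x ≠ x) {m : X} (hm : m ∈ omegaSet f x) {ε : ℝ} (hε : 0 < ε) :
    ∀ᶠ y in 𝓝 x, (omegaSet f y ∩ closedBall m ε).Nonempty := by
  have := hreg.locallyConnectedSpace
  obtain ⟨F, hF, hFd⟩ := hreg.exists_finite_dist_lt (half_pos hε)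
  have hfreq := (mem_omegaSet_iff f).1 hm _ (ball_mem_nhds m (half_pos hε))
  have hclose : ∀ {C : Set X}, IsPreconnected C → x ∈ C → ∀ {n : ℕ}, Disjoint ((f ^ n) '' C) F →
      (f ^ n) x ∈ ball m (ε / 2) → ∀ y ∈ C, (f ^ n) y ∈ closedBall m ε := by
    intro C hC hxC n hd hn y hy
    have h1 := hFd _ (hC.image _ (f ^ n : X ≃ₜ X).continuous.continuousOn) hd _
      (mem_image_of_mem _ hy) _ (mem_image_of_mem _ hxC)
    have h2 := mem_ball.1 hn
    exact mem_closedBall.2 (by linarith [dist_triangle ((f ^ n) y) ((f ^ n) x) m])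
  by_cases hxM : x ∈ omegaSet f x
  · obtain ⟨J, hJ, hJcard⟩ := (Nat.frequently_atTop_iff_infinite.1 hfreq).exists_subset_card_eq
      (hF.toFinset.card + 1)
    obtain ⟨L, hL⟩ : ∃ L, ∀ j ∈ J, j ≤ L := ⟨J.sup id, fun j hj => Finset.le_sup (f := id) hj⟩
    obtain ⟨C, hCx, -, hCp, hCd⟩ := exists_isPreconnected_nhds_disjoint_pow f hx L univ_mem
    have hO : ⋂ j ∈ J, (f ^ j : X ≃ₜ X) ⁻¹' ball m (ε / 2) ∈ 𝓝 x :=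
      (biInter_finset_mem J).2 fun j hj =>
        (f ^ j : X ≃ₜ X).continuous.continuousAt (isOpen_ball.mem_nhds (hJ hj))
    filter_upwards [hCx] with y hy
    refine omegaSet_inter_nonempty_of_frequently f isClosed_closedBall
      (frequently_atTop.2 fun N => ?_)
    obtain ⟨t, ht, htO⟩ := frequently_atTop.1 ((mem_omegaSet_iff f).1 hxM _ hO) N
    obtain ⟨n, hn, hnd⟩ := exists_mem_disjoint_pow_image f hCd (t := t)
      (J := J.image fun j => j + t) (F := hF.toFinset)
      (by
        intro n hn
        obtain ⟨j, hj, rfl⟩ := Finset.mem_image.1 hn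
        have := hL j hj
        omega)
      (by
        rw [Finset.card_image_of_injective _ (add_left_injective t), hJcard]
        exact Nat.lt_succ_self _)
    obtain ⟨j, hj, rfl⟩ := Finset.mem_image.1 hn
    rw [hF.coe_toFinset] at hnd
    refine ⟨j + t, by omega, hclose hCp (mem_of_mem_nhds hCx) hnd ?_ y hy⟩
    rw [f.pow_add_apply]
    exact mem_iInter₂.1 htO j hj
  · obtain ⟨C, hCx, -, hCp, hCd⟩ := exists_isPreconnected_nhds_eventually_disjoint f hF
      (fun g _ hg => hxM (omegaSet_inv_eq_of_mem f hreg hx hg ▸ hg)) univ_mem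
    filter_upwards [hCx] with y hy
    refine omegaSet_inter_nonempty_of_frequently f isClosed_closedBall ?_
    exact (hfreq.and_eventually hCd).mono fun n hn =>
      hclose hCp (mem_of_mem_nhds hCx) hn.2 hn.1 y hy

end Lower

section BackwardBasin

variable {X : Type*} [MetricSpace X] (f : X ≃ₜ X)

theorem omegaSet_pow_apply (k : ℕ) (x : X) : omegaSet f ((f ^ k) x) = omegaSet f x := by
  ext y
  rw [mem_omegaSet_iff, mem_omegaSet_iff]
  refine forall₂_congr fun V _ => ?_
  conv_rhs => rw [← map_add_atTop_eq_nat k, frequently_map]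
  simp only [f.pow_add_apply]

theorem mem_omegaSet_of_pow_apply_eq {k : ℕ} (hk : 0 < k) {x : X} (h : (f ^ k) x = x) :
    x ∈ omegaSet f x := by
  refine (mem_omegaSet_iff f).2 fun V hV => frequently_atTop.2 fun N =>
    ⟨k * N, Nat.le_mul_of_pos_left N hk, ?_⟩
  have hN : (f ^ (k * N)) x = x := by
    induction N with
    | zero => rfl
    | succ N ih => rw [Nat.mul_succ, f.pow_add_apply, h, ih]
  rw [hN]
  exact mem_of_mem_nhds hV

/-- The points outside `M` whose α-limit set is contained in `M`. -/
def backwardBasin (M : Set X) : Set X :=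
  {p | p ∉ M ∧ omegaSet (f⁻¹ : X ≃ₜ X) p ⊆ M}

/-- The set `H` stays away from `M`, and its backward iterates converge uniformly to `M`. -/
def RetractsBackward (M H : Set X) : Prop :=
  Disjoint (closure H) M ∧ ∀ U, IsOpen U → M ⊆ U → ∀ᶠ n : ℕ in atTop, (f⁻¹ ^ n : X ≃ₜ X) '' H ⊆ U

variable {f} {M : Set X}

theorem RetractsBackward.union {H H' : Set X} (h : RetractsBackward f M H)
    (h' : RetractsBackward f M H') : RetractsBackward f M (H ∪ H') := by
  refine ⟨?_, fun U hU hMU => ?_⟩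
  · rw [closure_union]
    exact h.1.union_left h'.1
  · filter_upwards [h.2 U hU hMU, h'.2 U hU hMU] with n h1 h2
    rw [image_union]
    exact union_subset h1 h2

theorem RetractsBackward.eventually_notMem {H : Set X} (h : RetractsBackward f M H)
    (hfM : ∀ y ∈ M, ∀ n, (f ^ n) y ∈ M) (g : X) :
    ∀ᶠ n : ℕ in atTop, g ∉ (f⁻¹ ^ n : X ≃ₜ X) '' H := by
  by_cases hg : g ∈ M
  · refine Eventually.of_forall fun n => ?_
    rintro ⟨u, hu, rfl⟩
    refine disjoint_left.1 h.1 (subset_closure hu) ?_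
    simpa only [f.pow_apply_inv_pow_apply] using hfM _ hg n
  · filter_upwards [h.2 _ isOpen_compl_singleton (subset_compl_singleton_iff.2 hg)] with n hn hgn
    exact hn hgn rfl

theorem RetractsBackward.subset_backwardBasin [CompactSpace X] {H : Set X}
    (h : RetractsBackward f M H) (hM : IsClosed M) : H ⊆ backwardBasin f M := by
  refine fun w hw => ⟨disjoint_left.1 h.1 (subset_closure hw), fun y hy => ?_⟩
  by_contra hyM
  obtain ⟨U, hU, hMU, hUy⟩ := normal_exists_closure_subset hM isOpen_compl_singleton
    (subset_compl_singleton_iff.2 hyM)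
  refine hUy (omegaSet_subset_of_eventually _ isClosed_closure ?_ hy) rfl
  filter_upwards [h.2 U hU hMU] with n hn
  exact subset_closure (hn (mem_image_of_mem _ hw))

theorem backwardBasin.pow_image (hfM : ∀ y ∈ M, ∀ n, (f ^ n) y ∈ M)
    (hfM' : ∀ y ∈ M, ∀ n, (f⁻¹ ^ n : X ≃ₜ X) y ∈ M) (k : ℕ) :
    (f ^ k) '' backwardBasin f M = backwardBasin f M := by
  ext u
  rw [f.mem_pow_image_iff]
  have h1 : (f⁻¹ ^ k) u ∈ M ↔ u ∈ M :=
    ⟨fun h => by simpa only [f.pow_apply_inv_pow_apply] using hfM _ h k, fun h => hfM' _ h k⟩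
  simp only [backwardBasin, mem_ofPred_eq, h1, omegaSet_pow_apply]

variable [CompactSpace X] [ConnectedSpace X]

theorem backwardBasin.exists_nhds (hreg : regularCurveAx X) (hM : IsClosed M) {p : X}
    (hp : p ∈ backwardBasin f M) :
    ∃ W ∈ 𝓝 p, IsPreconnected W ∧ RetractsBackward f M W := by
  have := hreg.locallyConnectedSpace
  have hper : ∀ k, 0 < k → (f ^ k) p ≠ p := fun k hk h =>
    hp.1 (hp.2 (mem_omegaSet_of_pow_apply_eq f⁻¹ hk (by
      conv_lhs => rw [← h]
      exact f.inv_pow_apply_pow_apply k p)))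
  obtain ⟨U, hU, hMU, hUp, hfin⟩ := hreg.exists_isOpen_closure_subset_finite_frontier hM
    isOpen_compl_singleton (subset_compl_singleton_iff.2 hp.1)
  have hO : (closure U)ᶜ ∈ 𝓝 p := isClosed_closure.isOpen_compl.mem_nhds fun h => hUp h rfl
  obtain ⟨W, hW, hWU, hWp, hWd⟩ := exists_isPreconnected_nhds_eventually_disjoint f⁻¹ hfin
    (fun g _ hg => by
      rw [inv_inv] at hg
      exact hp.1 (hp.2 (omegaSet_eq_inv_of_mem f hreg hper hg ▸ hg))) hO
  have hpW := mem_of_mem_nhds hW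
  have hback : ∀ {U' : Set X}, IsOpen U' → M ⊆ U' →
      (∀ᶠ n : ℕ in atTop, Disjoint ((f⁻¹ ^ n : X ≃ₜ X) '' W) (frontier U')) →
      ∀ᶠ n : ℕ in atTop, (f⁻¹ ^ n : X ≃ₜ X) '' W ⊆ U' := by
    intro U' hU' hMU' hd
    filter_upwards [hd, eventually_mem_of_omegaSet_subset _ hU' (hp.2.trans hMU')] with n hn hpn
    exact (hWp.image _ (f⁻¹ ^ n : X ≃ₜ X).continuous.continuousOn).subset_of_disjoint_frontier
      hU' hn ⟨_, mem_image_of_mem _ hpW, hpn⟩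
  obtain ⟨s, hs⟩ := eventually_atTop.1 (hback hU hMU hWd)
  have hWU' : W ⊆ Uᶜ := hWU.trans (compl_subset_compl.2 subset_closure)
  have hvisit : ∀ g, ∀ᶠ n : ℕ in atTop, g ∉ (f⁻¹ ^ n : X ≃ₜ X) '' W := by
    intro g
    by_contra hcon
    have hcon' := frequently_atTop.1 (not_eventually.1 hcon)
    obtain ⟨a, -, ha⟩ := hcon' 0
    obtain ⟨b, hb, hb'⟩ := hcon' (a + s)
    rw [not_not] at ha hb'
    obtain ⟨w, hw, rfl⟩ := hb'
    rw [(f⁻¹).mem_pow_image_iff, inv_inv, ← Nat.add_sub_cancel' (show a ≤ b by omega),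
      f⁻¹.pow_add_apply, f.pow_apply_inv_pow_apply] at ha
    exact hWU' ha (hs _ (by omega) (mem_image_of_mem _ hw))
  refine ⟨W, hW, hWp, ?_, fun V hV hMV => ?_⟩
  · exact disjoint_left.2 fun z hz hzM => closure_minimal hWU' hU.isClosed_compl hz (hMU hzM)
  · obtain ⟨U', hU', hMU', hUV', hfin'⟩ :=
      hreg.exists_isOpen_finite_frontier hM.isCompact hV hMV
    refine (hback hU' hMU' ?_).mono fun n hn => hn.trans hUV'
    filter_upwards [(eventually_all_finite hfin').2 fun g _ => hvisit g] with n hn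
    exact disjoint_right.2 hn

theorem backwardBasin.isOpen (hreg : regularCurveAx X) (hM : IsClosed M) :
    IsOpen (backwardBasin f M) :=
  isOpen_iff_mem_nhds.2 fun _ hp =>
    let ⟨_, hW, _, hWr⟩ := exists_nhds hreg hM hp
    mem_of_superset hW (hWr.subset_backwardBasin hM)

theorem backwardBasin.exists_retractsBackward (hreg : regularCurveAx X) (hM : IsClosed M)
    {Q : Set X} (hQ : IsPreconnected Q) (hQM : Q ⊆ backwardBasin f M) {p q : X} (hp : p ∈ Q)
    (hq : q ∈ Q) : ∃ H, IsPreconnected H ∧ RetractsBackward f M H ∧ p ∈ H ∧ q ∈ H := by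
  refine hQ.induction₂ (fun p q => ∃ H, IsPreconnected H ∧ RetractsBackward f M H ∧ p ∈ H ∧ q ∈ H)
    (fun a ha => ?_) ?_ ?_ hp hq
  · obtain ⟨W, hW, hWp, hWr⟩ := exists_nhds hreg hM (hQM ha)
    filter_upwards [mem_nhdsWithin_of_mem_nhds hW] with y hy
    exact ⟨W, hWp, hWr, mem_of_mem_nhds hW, hy⟩
  · rintro a b c - - - ⟨H, hH, hHr, ha, hb⟩ ⟨H', hH', hHr', hb', hc⟩
    exact ⟨H ∪ H', hH.union b hb hb' hH', hHr.union hHr', Or.inl ha, Or.inr hc⟩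
  · rintro a b - - ⟨H, hH, hHr, ha, hb⟩
    exact ⟨H, hH, hHr, hb, ha⟩

end BackwardBasin

section Upper

variable {X : Type*} [MetricSpace X] [CompactSpace X] {f : X ≃ₜ X}

/-- The orbits of the points of the closure of a wandering preconnected set are pairwise
asymptotic. -/
theorem tendsto_dist_of_disjoint_pow_image (hreg : regularCurveAx X) {Q : Set X}
    (hQ : IsPreconnected Q) (hd : ∀ k, 0 < k → Disjoint ((f ^ k : X ≃ₜ X) '' Q) Q) {u v : X}
    (hu : u ∈ closure Q) (hv : v ∈ closure Q) :
    Tendsto (fun n : ℕ => dist ((f ^ n) u) ((f ^ n) v)) atTop (𝓝 0) := by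
  rw [Metric.tendsto_nhds]
  intro ε hε
  obtain ⟨F, hF, hFd⟩ := hreg.exists_finite_dist_lt (half_pos hε)
  have hvisit : ∀ g, ∀ᶠ n : ℕ in atTop, g ∉ (f ^ n : X ≃ₜ X) '' Q := by
    intro g
    by_contra hcon
    have hcon' := frequently_atTop.1 (not_eventually.1 hcon)
    obtain ⟨a, -, ha⟩ := hcon' 0
    obtain ⟨b, hb, hb'⟩ := hcon' (a + 1)
    rw [not_not] at ha hb'
    obtain ⟨w, hw, rfl⟩ := hb'
    rw [f.mem_pow_image_iff, ← Nat.add_sub_cancel' (show a ≤ b by omega),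
      f.pow_add_apply, f.inv_pow_apply_pow_apply] at ha
    exact disjoint_left.1 (hd (b - a) (by omega)) (mem_image_of_mem _ hw) ha
  filter_upwards [(eventually_all_finite hF).2 fun g _ => hvisit g] with n hn
  have hle : dist ((f ^ n) u) ((f ^ n) v) ∈ closure (Iic (ε / 2)) := by
    refine map_mem_closure₂ (f := fun a b => dist ((f ^ n : X ≃ₜ X) a) ((f ^ n : X ≃ₜ X) b)) ?_
      hu hv
      fun a ha b hb => (hFd _ (hQ.image _ (f ^ n : X ≃ₜ X).continuous.continuousOn)
        (disjoint_right.2 hn) _ (mem_image_of_mem _ ha) _ (mem_image_of_mem _ hb)).le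
    exact ((f ^ n : X ≃ₜ X).continuous.comp continuous_fst).dist
      ((f ^ n : X ≃ₜ X).continuous.comp continuous_snd)
  rw [isClosed_Iic.closure_eq, mem_Iic] at hle
  rw [Real.dist_0_eq_abs, abs_of_nonneg dist_nonneg]
  linarith

variable [ConnectedSpace X] {M : Set X}

theorem backwardBasin.disjoint_pow_image_component (hreg : regularCurveAx X) (hM : IsClosed M)
    (hfM : ∀ y ∈ M, ∀ n, (f ^ n) y ∈ M) (hfM' : ∀ y ∈ M, ∀ n, (f⁻¹ ^ n : X ≃ₜ X) y ∈ M) {p : X}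
    (hp : p ∈ backwardBasin f M) (hinf : (omegaSet (f⁻¹ : X ≃ₜ X) p).Infinite) {k : ℕ}
    (hk : 0 < k) :
    Disjoint ((f ^ k) '' connectedComponentIn (backwardBasin f M) p)
      (connectedComponentIn (backwardBasin f M) p) := by
  rw [disjoint_left]
  intro u hu hu'
  have himage := (f ^ k : X ≃ₜ X).image_connectedComponentIn hp
  rw [backwardBasin.pow_image hfM hfM'] at himage
  have heq : (f ^ k) '' connectedComponentIn (backwardBasin f M) p =
      connectedComponentIn (backwardBasin f M) p := by
    rw [himage] at hu ⊢
    rw [connectedComponentIn_eq hu, connectedComponentIn_eq hu']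
  have hpQ := mem_connectedComponentIn hp
  have hq : (f⁻¹ ^ k) p ∈ connectedComponentIn (backwardBasin f M) p :=
    f.mem_pow_image_iff.1 (heq.symm ▸ hpQ)
  obtain ⟨H, hH, hHr, hpH, hqH⟩ := backwardBasin.exists_retractsBackward hreg hM
    isPreconnected_connectedComponentIn (connectedComponentIn_subset _ _) hpQ hq
  have hinf' : (omegaSet (f⁻¹ ^ k : X ≃ₜ X) p).Infinite := fun hfin =>
    hinf (((Finset.finite_toSet _).biUnion fun r _ => hfin.image _).subset
      (omegaSet_subset_biUnion_pow f⁻¹ hk p))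
  obtain ⟨c, hc, c', hc', hne⟩ := hinf'.nontrivial
  have hε : 0 < dist c c' / 3 := by linarith [dist_pos.2 hne]
  obtain ⟨F, hF, hFd⟩ := hreg.exists_finite_dist_lt hε
  obtain ⟨N, hN⟩ := eventually_atTop.1
    ((eventually_all_finite hF).2 fun g _ => hHr.eventually_notMem hfM g)
  have hT : IsPreconnected (⋃ n : ℕ, (f⁻¹ ^ (k * (n + N)) : X ≃ₜ X) '' H) := by
    refine IsPreconnected.iUnion_of_chain
      (fun n => hH.image _ (f⁻¹ ^ (k * (n + N)) : X ≃ₜ X).continuous.continuousOn)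
      fun n => ⟨_, mem_image_of_mem _ hqH, p, hpH, ?_⟩
    rw [← f⁻¹.pow_add_apply, ← Nat.mul_succ, Order.succ_eq_add_one, Nat.succ_eq_add_one,
      Nat.add_right_comm]
  have hTF : Disjoint (⋃ n : ℕ, (f⁻¹ ^ (k * (n + N)) : X ≃ₜ X) '' H) F := by
    refine disjoint_iUnion_left.2 fun n => disjoint_right.2 fun g hg => hN _ ?_ g hg
    exact (Nat.le_add_left N n).trans (Nat.le_mul_of_pos_left _ hk)
  have hnear : ∀ d ∈ omegaSet (f⁻¹ ^ k : X ≃ₜ X) p,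
      ∃ a ∈ ⋃ n : ℕ, (f⁻¹ ^ (k * (n + N)) : X ≃ₜ X) '' H, dist a d < dist c c' / 3 := by
    intro d hd
    obtain ⟨n, hn, hnd⟩ := frequently_atTop.1 ((mem_omegaSet_iff _).1 hd _ (ball_mem_nhds d hε)) N
    rw [← Nat.sub_add_cancel hn, ← pow_mul] at hnd
    exact ⟨_, mem_iUnion.2 ⟨n - N, mem_image_of_mem _ hpH⟩, hnd⟩
  obtain ⟨a, haT, ha⟩ := hnear c hc
  obtain ⟨b, hbT, hb⟩ := hnear c' hc'
  have hab := hFd _ hT hTF a haT b hbT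
  linarith [dist_triangle4 c a b c', dist_comm a c]

theorem backwardBasin.isOpen_component (hreg : regularCurveAx X) (hM : IsClosed M) (p : X) :
    IsOpen (connectedComponentIn (backwardBasin f M) p) := by
  have := hreg.locallyConnectedSpace
  exact (backwardBasin.isOpen hreg hM).connectedComponentIn

theorem backwardBasin.frontier_component_subset (hreg : regularCurveAx X) (hM : IsClosed M)
    (hfM : ∀ y ∈ M, ∀ n, (f ^ n) y ∈ M) (hfM' : ∀ y ∈ M, ∀ n, (f⁻¹ ^ n : X ≃ₜ X) y ∈ M) {p : X}
    (hp : p ∈ backwardBasin f M) (hinf : (omegaSet (f⁻¹ : X ≃ₜ X) p).Infinite) :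
    frontier (connectedComponentIn (backwardBasin f M) p) ⊆ M := by
  intro z hz
  by_contra hzM
  have hd : ∀ k, 0 < k → Disjoint
      ((f⁻¹ ^ k : X ≃ₜ X) '' connectedComponentIn (backwardBasin f M) p)
      (connectedComponentIn (backwardBasin f M) p) := by
    intro k hk
    refine disjoint_left.2 ?_
    rintro _ ⟨w, hw, rfl⟩ hw'
    exact disjoint_left.1 (disjoint_pow_image_component hreg hM hfM hfM' hp hinf hk)
      ⟨_, hw', f.pow_apply_inv_pow_apply k w⟩ hw
  have hzP : z ∈ backwardBasin f M := ⟨hzM, (omegaSet_subset_of_tendsto_dist _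
    (tendsto_dist_of_disjoint_pow_image hreg isPreconnected_connectedComponentIn hd hz.1
      (subset_closure (mem_connectedComponentIn hp)))).trans hp.2⟩
  obtain ⟨w, hwz, hwp⟩ := mem_closure_iff.1 hz.1 _ (isOpen_component hreg hM z)
    (mem_connectedComponentIn hzP)
  have hzQ : z ∈ connectedComponentIn (backwardBasin f M) p := by
    rw [connectedComponentIn_eq hwp, ← connectedComponentIn_eq hwz]
    exact mem_connectedComponentIn hzP
  exact hz.2 (by rwa [(isOpen_component hreg hM p).interior_eq])

theorem backwardBasin.omegaSet_subset_of_mem_component (hreg : regularCurveAx X)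
    (hM : IsClosed M) (hMne : M.Nonempty)
    (hfM : ∀ y ∈ M, ∀ n, (f ^ n) y ∈ M) (hfM' : ∀ y ∈ M, ∀ n, (f⁻¹ ^ n : X ≃ₜ X) y ∈ M) {p : X}
    (hp : p ∈ backwardBasin f M) (hinf : (omegaSet (f⁻¹ : X ≃ₜ X) p).Infinite) {y : X}
    (hy : y ∈ connectedComponentIn (backwardBasin f M) p) : omegaSet f y ⊆ M := by
  obtain ⟨m, hm⟩ := hMne
  obtain ⟨z, hz⟩ := nonempty_frontier_iff.2 ⟨⟨y, hy⟩, fun h =>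
    (connectedComponentIn_subset _ _ (h ▸ mem_univ m :
      m ∈ connectedComponentIn (backwardBasin f M) p)).1 hm⟩
  refine (omegaSet_subset_of_tendsto_dist _ (tendsto_dist_of_disjoint_pow_image hreg
    isPreconnected_connectedComponentIn
    (fun k hk => disjoint_pow_image_component hreg hM hfM hfM' hp hinf hk)
    (subset_closure hy) hz.1)).trans
    (omegaSet_subset_of_eventually f hM (Eventually.of_forall fun n => hfM _ ?_ n))
  exact frontier_component_subset hreg hM hfM hfM' hp hinf hz

theorem eventually_omegaSet_subset (hreg : regularCurveAx X) {x : X}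
    (hinf : (omegaSet f x).Infinite) {V : Set X} (hV : IsOpen V) (hxV : omegaSet f x ⊆ V) :
    ∀ᶠ y in 𝓝 x, omegaSet f y ⊆ V := by
  have := hreg.locallyConnectedSpace
  have hx : ∀ k, 0 < k → (f ^ k) x ≠ x := fun k hk => pow_apply_ne_of_infinite_omegaSet f hinf hk
  have hM := isClosed_omegaSet f x
  have hfM : ∀ y ∈ omegaSet f x, ∀ n, (f ^ n) y ∈ omegaSet f x :=
    fun y hy => pow_apply_mem_omegaSet f hy
  have hfM' : ∀ y ∈ omegaSet f x, ∀ n, (f⁻¹ ^ n : X ≃ₜ X) y ∈ omegaSet f x :=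
    fun y hy => inv_pow_apply_mem_omegaSet f hy
  obtain ⟨U, hU, hMU, hUV, hfin⟩ :=
    hreg.exists_isOpen_closure_subset_finite_frontier hM hV hxV
  let S : Set X := {p ∈ frontier U | x ∈ omegaSet (f⁻¹ : X ≃ₜ X) p}
  have hSfin : S.Finite := hfin.subset fun p hp => hp.1
  have hSα : ∀ p ∈ S, omegaSet (f⁻¹ : X ≃ₜ X) p = omegaSet f x :=
    fun p hp => omegaSet_inv_eq_of_mem f hreg hx hp.2
  have hSP : ∀ p ∈ S, p ∈ backwardBasin f (omegaSet f x) := fun p hp =>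
    ⟨fun hpM => hp.1.2 (by rw [hU.interior_eq]; exact hMU hpM), (hSα p hp).subset⟩
  let Q : X → Set X := fun p => connectedComponentIn (backwardBasin f (omegaSet f x)) p
  have hQo : ∀ p, IsOpen (Q p) := fun p => backwardBasin.isOpen_component hreg hM p
  have hV'o : IsOpen (U ∪ ⋃ p ∈ S, Q p) := hU.union (isOpen_biUnion fun p _ => hQo p)
  have hfr : ∀ z ∈ frontier (U ∪ ⋃ p ∈ S, Q p), z ∈ frontier U ∧ z ∉ S := by
    intro z hz
    rw [hV'o.frontier_eq, closure_union, hSfin.closure_biUnion] at hz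
    obtain ⟨hz, hz'⟩ := hz
    rw [mem_union, not_or, mem_iUnion₂] at hz'
    have hzS : z ∉ S := fun h => hz'.2 ⟨z, h, mem_connectedComponentIn (hSP z h)⟩
    rcases hz with hz | hz
    · exact ⟨by rw [hU.frontier_eq]; exact ⟨hz, hz'.1⟩, hzS⟩
    · obtain ⟨p, hp, hzp⟩ := mem_iUnion₂.1 hz
      refine absurd (hMU (backwardBasin.frontier_component_subset hreg hM hfM hfM' (hSP p hp)
        ((hSα p hp).symm ▸ hinf) ?_)) hz'.1
      rw [(hQo p).frontier_eq]
      exact ⟨hzp, fun h => hz'.2 ⟨p, hp, h⟩⟩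
  obtain ⟨C, hCx, -, hCp, hCd⟩ := exists_isPreconnected_nhds_eventually_disjoint f
    (hfin.subset fun z hz => (hfr z hz).1)
    (fun g hg hxg => (hfr g hg).2 ⟨(hfr g hg).1, hxg⟩) univ_mem
  filter_upwards [hCx] with y hy
  have hyV' : ∀ᶠ n : ℕ in atTop, (f ^ n) y ∈ U ∪ ⋃ p ∈ S, Q p := by
    filter_upwards [hCd, eventually_mem_of_omegaSet_subset f hU hMU] with n hn hnU
    exact (hCp.image _ (f ^ n : X ≃ₜ X).continuous.continuousOn).subset_of_disjoint_frontier
      hV'o hn ⟨_, mem_image_of_mem _ (mem_of_mem_nhds hCx), Or.inl hnU⟩ (mem_image_of_mem _ hy)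
  by_cases hex : ∃ n, ∃ p ∈ S, (f ^ n) y ∈ Q p
  · obtain ⟨n, p, hp, hn⟩ := hex
    rw [← omegaSet_pow_apply f n y]
    exact (backwardBasin.omegaSet_subset_of_mem_component hreg hM hinf.nonempty hfM hfM'
      (hSP p hp) ((hSα p hp).symm ▸ hinf) hn).trans hxV
  · refine (omegaSet_subset_of_eventually f isClosed_closure ?_).trans hUV
    filter_upwards [hyV'] with n hn
    refine subset_closure (hn.resolve_right fun h => hex ?_)
    obtain ⟨p, hp, hpn⟩ := mem_iUnion₂.1 h
    exact ⟨n, p, hp, hpn⟩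

end Upper

/-- The map x ↦ ω_f(x) is continuous (for the Hausdorff metric) at every point
whose ω-limit set is infinite. -/
theorem omegaMap_continuousAt_of_infinite {X : Type*} [MetricSpace X] [Nonempty X]
    [CompactSpace X] [ConnectedSpace X] (hreg : regularCurveAx X) (f : X ≃ₜ X)
    (x : X) (hinf : (omegaSet (⇑f) x).Infinite) :
    ∀ ε > 0, ∃ δ > 0, ∀ y : X, dist y x < δ →
      hausdorffDist (omegaSet (⇑f) y) (omegaSet (⇑f) x) < ε := by
  intro ε hε
  rw [← Metric.eventually_nhds_iff]
  have hx : ∀ k, 0 < k → (f ^ k) x ≠ x := fun k hk => pow_apply_ne_of_infinite_omegaSet f hinf hk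
  obtain ⟨t, htM, ht⟩ := (isClosed_omegaSet f x).isCompact.elim_nhds_subcover
    (fun m => ball m (ε / 4)) fun m _ => ball_mem_nhds m (by linarith)
  have hlower := (eventually_all_finset t).2 fun m hm =>
    eventually_omegaSet_inter_closedBall_nonempty f hreg hx (htM m hm)
      (show 0 < ε / 4 by linarith)
  have hupper := eventually_omegaSet_subset hreg hinf
    (isOpen_thickening (δ := ε / 2) (E := omegaSet f x))
    (self_subset_thickening (by linarith) _)
  filter_upwards [hlower, hupper] with y hl hu
  refine (hausdorffDist_le_of_mem_dist (half_pos hε).le (fun a ha => ?_) fun m hm => ?_).trans_lt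
    (half_lt_self hε)
  · obtain ⟨z, hz, hd⟩ := mem_thickening_iff.1 (hu ha)
    exact ⟨z, hz, hd.le⟩
  · obtain ⟨r, hr, hmr⟩ := mem_iUnion₂.1 (ht hm)
    obtain ⟨a, ha, har⟩ := hl r hr
    refine ⟨a, ha, ?_⟩
    linarith [dist_triangle_right m a r, mem_ball.1 hmr, mem_closedBall.1 har]
end
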